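/- arXiv:2205.12200 — 10 statements merged into one kernel-verified Lean document; each statement's English description precedes it below -/
import Mathlib

section
/- Let α ∈ ℝ with |α| < 1 and let f : ℝ → ℝ be five times continuously differentiable on a neighbourhood of [0,1], satisfying f(0) = f(1) = f'(0) = f'(1) = 0 and f''(1) = α·f''(0). Then ∫₀¹ (−f'''(x) + f⁽⁵⁾(x))·f(x) dx = (1/2)·(α² − 1)·(f''(0))², and in particular this integral is ≤ 0 (dissipativity of the Kawahara operator A u = −u''' + u⁽⁵⁾). -/
/-- Dissipativity of the Kawahara operator `A u = -u''' + u⁽⁵⁾`: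
for `f` five times continuously differentiable on a neighbourhood of `[0,1]`
satisfying the Kawahara boundary conditions with `|α| < 1`, one has
`∫₀¹ (-f''' + f⁽⁵⁾) f = (1/2)(α² - 1) (f''(0))² ≤ 0`. -/
theorem kawahara_dissipative (α : ℝ) (hα : |α| < 1) (f : ℝ → ℝ)
    (s : Set ℝ) (hs : IsOpen s) (hsub : Set.Icc (0:ℝ) 1 ⊆ s)
    (hf : ContDiffOn ℝ 5 f s)
    (h0 : f 0 = 0) (h1 : f 1 = 0)
    (hd0 : deriv f 0 = 0) (hd1 : deriv f 1 = 0)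
    (hdd : iteratedDeriv 2 f 1 = α * iteratedDeriv 2 f 0) :
    (∫ x in (0:ℝ)..1, (-iteratedDeriv 3 f x + iteratedDeriv 5 f x) * f x)
      = (1/2) * (α^2 - 1) * (iteratedDeriv 2 f 0)^2 ∧
    (∫ x in (0:ℝ)..1, (-iteratedDeriv 3 f x + iteratedDeriv 5 f x) * f x) ≤ 0 := by
  have hcont : ∀ k : ℕ, k ≤ 5 → ContinuousOn (iteratedDeriv k f) s := by
    intro k hk
    refine ContinuousOn.congr (hf.continuousOn_iteratedDerivWithin (m := k)
      (by exact_mod_cast hk) hs.uniqueDiffOn) ?_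
    exact (iteratedDerivWithin_of_isOpen hs).symm
  have hder : ∀ k : ℕ, k < 5 → ∀ x ∈ s,
      HasDerivAt (iteratedDeriv k f) (iteratedDeriv (k + 1) f x) x := by
    intro k hk x hx
    have h := hf.differentiableOn_iteratedDerivWithin (m := k)
      (by exact_mod_cast hk) hs.uniqueDiffOn
    have h2 : DifferentiableOn ℝ (iteratedDeriv k f) s :=
      h.congr (iteratedDerivWithin_of_isOpen hs).symm
    rw [iteratedDeriv_succ]
    exact ((h2 x hx).differentiableAt (hs.mem_nhds hx)).hasDerivAt
  have hsub' : Set.uIcc (0:ℝ) 1 ⊆ s := by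
    rwa [Set.uIcc_of_le zero_le_one]
  have key : (∫ x in (0:ℝ)..1, (-iteratedDeriv 3 f x + iteratedDeriv 5 f x) * f x)
      = (1/2) * (α^2 - 1) * (iteratedDeriv 2 f 0)^2 := by
    have hI : IntervalIntegrable
        (fun x => (-iteratedDeriv 3 f x + iteratedDeriv 5 f x) * f x)
        MeasureTheory.volume 0 1 := by
      apply ContinuousOn.intervalIntegrable
      exact (((hcont 3 (by norm_num)).neg.add (hcont 5 le_rfl)).mul hf.continuousOn).mono hsub'
    have hF := intervalIntegral.integral_eq_sub_of_hasDerivAt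
      (f := fun x => -(iteratedDeriv 2 f x * iteratedDeriv 0 f x)
        + iteratedDeriv 1 f x * iteratedDeriv 1 f x / 2
        + iteratedDeriv 4 f x * iteratedDeriv 0 f x
        - iteratedDeriv 3 f x * iteratedDeriv 1 f x
        + iteratedDeriv 2 f x * iteratedDeriv 2 f x / 2) (fun x hx => by
        have hx' := hsub' hx
        have d0 := hder 0 (by norm_num) x hx'
        have d1 := hder 1 (by norm_num) x hx'
        have d2 := hder 2 (by norm_num) x hx'
        have d3 := hder 3 (by norm_num) x hx'
        have d4 := hder 4 (by norm_num) x hx'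
        have H := (((((d2.mul d0).neg).add ((d1.mul d1).div_const 2)).add (d4.mul d0)).sub
          (d3.mul d1)).add ((d2.mul d2).div_const 2)
        refine H.congr_deriv ?_
        simp only [iteratedDeriv_zero]
        ring) hI
    rw [hF]
    simp only [iteratedDeriv_zero, iteratedDeriv_one, h0, h1, hd0, hd1, hdd]
    ring
  refine ⟨key, ?_⟩
  rw [key]
  have hα2 : α ^ 2 < 1 := (sq_lt_one_iff_abs_lt_one α).2 hα
  nlinarith [mul_nonneg (sub_nonneg.2 hα2.le) (sq_nonneg (iteratedDeriv 2 f 0))]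
end

section
/- Let α ∈ ℝ with |α| < 1 and let g : ℝ → ℝ be five times continuously differentiable on a neighbourhood of [0,1], satisfying g(0) = g(1) = g'(0) = g'(1) = 0 and g''(0) = α·g''(1). Then ∫₀¹ (g'''(x) − g⁽⁵⁾(x))·g(x) dx = (1/2)·(α² − 1)·(g''(1))², and in particular this integral is ≤ 0 (dissipativity of the adjoint operator A* v = v''' − v⁽⁵⁾). -/
/-- Dissipativity of the adjoint Kawahara operator `A* v = v''' - v⁽⁵⁾`:
for `g` five times continuously differentiable on a neighbourhood of `[0,1]`
satisfying the adjoint boundary conditions with `|α| < 1`, one has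
`∫₀¹ (g''' - g⁽⁵⁾) g = (1/2)(α² - 1) (g''(1))² ≤ 0`. -/
theorem kawahara_adjoint_dissipative (α : ℝ) (hα : |α| < 1) (g : ℝ → ℝ)
    (s : Set ℝ) (hs : IsOpen s) (hsub : Set.Icc (0:ℝ) 1 ⊆ s)
    (hg : ContDiffOn ℝ 5 g s)
    (h0 : g 0 = 0) (h1 : g 1 = 0)
    (hd0 : deriv g 0 = 0) (hd1 : deriv g 1 = 0)
    (hdd : iteratedDeriv 2 g 0 = α * iteratedDeriv 2 g 1) :
    (∫ x in (0:ℝ)..1, (iteratedDeriv 3 g x - iteratedDeriv 5 g x) * g x)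
      = (1/2) * (α^2 - 1) * (iteratedDeriv 2 g 1)^2 ∧
    (∫ x in (0:ℝ)..1, (iteratedDeriv 3 g x - iteratedDeriv 5 g x) * g x) ≤ 0 := by
  have hd : ∀ m : ℕ, m < 5 → ∀ x ∈ s,
      HasDerivAt (iteratedDeriv m g) (iteratedDeriv (m + 1) g x) x := by
    intro m hm x hx
    have h := hg.differentiableOn_iteratedDerivWithin (m := m) (by exact_mod_cast hm)
      hs.uniqueDiffOn
    have h' : DifferentiableOn ℝ (iteratedDeriv m g) s :=
      h.congr fun y hy => (iteratedDerivWithin_of_isOpen hs hy).symm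
    rw [iteratedDeriv_succ]
    exact ((h' x hx).differentiableAt (hs.mem_nhds hx)).hasDerivAt
  have hc5 : ContinuousOn (iteratedDeriv 5 g) s :=
    (hg.continuousOn_iteratedDerivWithin (m := 5) (by norm_num) hs.uniqueDiffOn).congr
      fun y hy => (iteratedDerivWithin_of_isOpen hs hy).symm
  have hc3 : ContinuousOn (iteratedDeriv 3 g) s :=
    fun x hx => (hd 3 (by norm_num) x hx).continuousAt.continuousWithinAt
  have hu : Set.uIcc (0:ℝ) 1 ⊆ s := by rwa [Set.uIcc_of_le zero_le_one]
  have key : (∫ x in (0:ℝ)..1, (iteratedDeriv 3 g x - iteratedDeriv 5 g x) * g x)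
      = (1/2) * (α^2 - 1) * (iteratedDeriv 2 g 1)^2 := by
    have hF := intervalIntegral.integral_eq_sub_of_hasDerivAt (a := 0) (b := 1)
      (f := fun x => iteratedDeriv 2 g x * g x - iteratedDeriv 1 g x * iteratedDeriv 1 g x * (1/2)
        - (iteratedDeriv 4 g x * g x - iteratedDeriv 3 g x * iteratedDeriv 1 g x
          + iteratedDeriv 2 g x * iteratedDeriv 2 g x * (1/2)))
      (f' := fun x => (iteratedDeriv 3 g x - iteratedDeriv 5 g x) * g x)
      (by
        intro x hx
        have hx' := hu hx
        have d0 := hd 0 (by norm_num) x hx'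
        have d1 := hd 1 (by norm_num) x hx'
        have d2 := hd 2 (by norm_num) x hx'
        have d3 := hd 3 (by norm_num) x hx'
        have d4 := hd 4 (by norm_num) x hx'
        rw [iteratedDeriv_zero] at d0
        norm_num only at d0 d1 d2 d3 d4
        exact (((d2.mul d0).sub ((d1.mul d1).mul_const (1/2))).sub
          (((d4.mul d0).sub (d3.mul d1)).add ((d2.mul d2).mul_const (1/2)))).congr_deriv
            (by ring))
      (((hc3.sub hc5).mul hg.continuousOn).mono hu).intervalIntegrable
    rw [hF]
    simp only [iteratedDeriv_one, h0, h1, hd0, hd1, hdd]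
    ring
  refine ⟨key, ?_⟩
  rw [key]
  have h2 : α ^ 2 < 1 := (sq_lt_one_iff_abs_lt_one α).2 hα
  nlinarith [mul_nonneg (sub_nonneg.2 h2.le) (sq_nonneg (iteratedDeriv 2 g 1))]
end

section
/- Let u be a classical solution of the damped linear Kawahara system. Then for every t ∈ ℝ the energy E(t) = ∫₀¹ u(x,t)² dx is differentiable in t with E'(t) = (α² − 1)·(∂ₓ²u(0,t))²; in particular E is nonincreasing. -/
/-- For a classical solution of the damped linear Kawahara system,
the energy `E(t) = ∫₀¹ u(x,t)² dx` is differentiable in `t` with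
`E'(t) = (α² - 1) (∂ₓ²u(0,t))²`; in particular `E` is nonincreasing. -/
theorem kawahara_energy_deriv (α : ℝ) (hα : |α| < 1) (u : ℝ → ℝ → ℝ)
    (hu : ContDiff ℝ (⊤ : ℕ∞) (Function.uncurry u))
    (hpde : ∀ x ∈ Set.Icc (0:ℝ) 1, ∀ t : ℝ,
      deriv (u x) t + iteratedDeriv 3 (fun y => u y t) x
        - iteratedDeriv 5 (fun y => u y t) x = 0)
    (hbc0 : ∀ t : ℝ, u 0 t = 0) (hbc1 : ∀ t : ℝ, u 1 t = 0)
    (hbx0 : ∀ t : ℝ, deriv (fun y => u y t) 0 = 0)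
    (hbx1 : ∀ t : ℝ, deriv (fun y => u y t) 1 = 0)
    (hbxx : ∀ t : ℝ, iteratedDeriv 2 (fun y => u y t) 1
      = α * iteratedDeriv 2 (fun y => u y t) 0) :
    (∀ t : ℝ, HasDerivAt (fun s => ∫ x in (0:ℝ)..1, (u x s)^2)
      ((α^2 - 1) * (iteratedDeriv 2 (fun y => u y t) 0)^2) t) ∧
    Antitone (fun t => ∫ x in (0:ℝ)..1, (u x t)^2) := by
  have h0 : ∀ t : ℝ, HasDerivAt (fun s => ∫ x in (0:ℝ)..1, (u x s)^2)
      ((α^2 - 1) * (iteratedDeriv 2 (fun y => u y t) 0)^2) t := by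
    intro t
    have hut : ∀ x s, HasDerivAt (u x) (fderiv ℝ (Function.uncurry u) (x, s) (0, 1)) s := by
      intro x s
      have h1 : HasFDerivAt (Function.uncurry u) (fderiv ℝ (Function.uncurry u) (x, s)) (x, s) :=
        (hu.differentiable (by simp) (x, s)).hasFDerivAt
      have h2 : HasDerivAt (fun r : ℝ => (x, r)) ((0 : ℝ), (1 : ℝ)) s :=
        (hasDerivAt_const s x).prodMk (hasDerivAt_id s)
      exact h1.comp_hasDerivAt s h2
    have hcf : Continuous (fun p : ℝ × ℝ => fderiv ℝ (Function.uncurry u) p (0, 1)) :=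
      (hu.continuous_fderiv (by simp)).clm_apply continuous_const
    have hcu : Continuous (fun p : ℝ × ℝ => u p.1 p.2) := hu.continuous
    have hcG : Continuous (fun p : ℝ × ℝ =>
        2 * u p.1 p.2 * fderiv ℝ (Function.uncurry u) p (0, 1)) :=
      (continuous_const.mul hcu).mul hcf
    obtain ⟨C, hC⟩ := ((isCompact_Icc (a := (0:ℝ)) (b := 1)).prod
      (isCompact_Icc (a := t - 1) (b := t + 1))).exists_bound_of_continuousOn hcG.continuousOn
    have hsec : ∀ s, Continuous (fun x => u x s) := fun s =>
      hcu.comp (continuous_id.prodMk continuous_const)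
    have hGsec : Continuous (fun x =>
        2 * u x t * fderiv ℝ (Function.uncurry u) (x, t) (0, 1)) :=
      hcG.comp (continuous_id.prodMk continuous_const)
    have key := (intervalIntegral.hasDerivAt_integral_of_dominated_loc_of_deriv_le
      (μ := MeasureTheory.volume) (a := 0) (b := 1)
      (F := fun s x => (u x s)^2)
      (F' := fun s x => 2 * u x s * fderiv ℝ (Function.uncurry u) (x, s) (0, 1))
      (x₀ := t) (s := Set.Icc (t - 1) (t + 1)) (bound := fun _ => C)
      (Icc_mem_nhds (by linarith) (by linarith))
      (Filter.Eventually.of_forall fun s => ((hsec s).pow 2).aestronglyMeasurable)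
      (((hsec t).pow 2).intervalIntegrable _ _)
      hGsec.aestronglyMeasurable
      (Filter.Eventually.of_forall fun x hx s hs => by
        rw [Set.uIoc_of_le zero_le_one] at hx
        exact hC (x, s) ⟨⟨hx.1.le, hx.2⟩, hs⟩)
      intervalIntegrable_const
      (Filter.Eventually.of_forall fun x hx s hs => by
        have h3 := (hut x s).pow 2
        norm_num at h3
        exact h3)).2
    refine HasDerivAt.congr_deriv key ?_
    set f : ℝ → ℝ := fun y => u y t with hf
    have hfs : ContDiff ℝ (⊤ : ℕ∞) f := hu.comp (contDiff_id.prodMk contDiff_const)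
    have hd : ∀ n x, HasDerivAt (iteratedDeriv n f) (iteratedDeriv (n + 1) f x) x := by
      intro n x
      rw [iteratedDeriv_succ]
      exact (hfs.differentiable_iteratedDeriv n
        (by exact_mod_cast ENat.natCast_lt_top n) x).hasDerivAt
    have hint := intervalIntegral.integral_eq_sub_of_hasDerivAt (a := 0) (b := 1)
      (f := fun x => 2 * (iteratedDeriv 0 f x * iteratedDeriv 4 f x)
        - 2 * (iteratedDeriv 1 f x * iteratedDeriv 3 f x) + (iteratedDeriv 2 f x)^2
        - 2 * (iteratedDeriv 0 f x * iteratedDeriv 2 f x) + (iteratedDeriv 1 f x)^2)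
      (f' := fun x => 2 * u x t * fderiv ℝ (Function.uncurry u) (x, t) (0, 1))
      (fun x hx => by
        rw [Set.uIcc_of_le zero_le_one] at hx
        have hp := hpde x hx t
        rw [(hut x t).deriv] at hp
        have := ((((((hd 0 x).mul (hd 4 x)).const_mul 2).sub
          (((hd 1 x).mul (hd 3 x)).const_mul 2)).add ((hd 2 x).pow 2)).sub
          (((hd 0 x).mul (hd 2 x)).const_mul 2)).add ((hd 1 x).pow 2)
        refine this.congr_deriv ?_
        have e0 : iteratedDeriv 0 f x = u x t := by simp [hf]
        have e : fderiv ℝ (Function.uncurry u) (x, t) (0, 1)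
          = iteratedDeriv 5 f x - iteratedDeriv 3 f x := by linarith
        rw [e, e0]
        norm_num
        ring)
      (hGsec.intervalIntegrable _ _)
    rw [hint]
    have a0 : f 0 = 0 := hbc0 t
    have a1 : f 1 = 0 := hbc1 t
    have b0 : deriv f 0 = 0 := hbx0 t
    have b1 : deriv f 1 = 0 := hbx1 t
    have c : iteratedDeriv 2 f 1 = α * iteratedDeriv 2 f 0 := hbxx t
    simp only [iteratedDeriv_zero, iteratedDeriv_one, a0, a1, b0, b1, c]
    ring
  refine ⟨h0, antitone_of_deriv_nonpos (fun t => (h0 t).differentiableAt) fun t => ?_⟩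
  rw [(h0 t).deriv]
  have h1 : α^2 < 1 := (sq_lt_one_iff_abs_lt_one α).2 hα
  exact mul_nonpos_of_nonpos_of_nonneg (by linarith) (sq_nonneg _)
end

section
/- Let u be a classical solution of the damped linear Kawahara system. Then for every T ≥ 0 one has ∫₀¹ u(x,T)² dx ≤ ∫₀¹ u(x,0)² dx. -/
/-- Integration by parts in space: an explicit antiderivative of the energy flux. -/
lemma kawahara_space_integral (v : ℝ → ℝ) (hv : ContDiff ℝ (⊤ : ℕ∞) v) (α : ℝ) (hα : |α| < 1)
    (h0 : v 0 = 0) (h1 : v 1 = 0) (h0' : deriv v 0 = 0) (h1' : deriv v 1 = 0)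
    (h2 : iteratedDeriv 2 v 1 = α * iteratedDeriv 2 v 0) :
    (∫ x in (0:ℝ)..1, 2 * v x * (iteratedDeriv 5 v x - iteratedDeriv 3 v x)) ≤ 0 := by
  have hd : ∀ (n : ℕ) (x : ℝ), HasDerivAt (iteratedDeriv n v) (iteratedDeriv (n + 1) v x) x := by
    intro n x
    rw [iteratedDeriv_succ]
    exact ((hv.differentiable_iteratedDeriv n (by exact_mod_cast WithTop.coe_lt_top n)) x).hasDerivAt
  have hc : ∀ n : ℕ, Continuous (iteratedDeriv n v) := fun n =>
    continuous_iff_continuousAt.2 fun x => (hd n x).continuousAt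
  have hF : ∀ x : ℝ, HasDerivAt (fun x => 2 * (iteratedDeriv 0 v x * iteratedDeriv 4 v x)
      - 2 * (iteratedDeriv 1 v x * iteratedDeriv 3 v x) + iteratedDeriv 2 v x * iteratedDeriv 2 v x
      - 2 * (iteratedDeriv 0 v x * iteratedDeriv 2 v x)
      + iteratedDeriv 1 v x * iteratedDeriv 1 v x)
      (2 * v x * (iteratedDeriv 5 v x - iteratedDeriv 3 v x)) x := by
    intro x
    have := ((((((hd 0 x).mul (hd 4 x)).const_mul 2).sub (((hd 1 x).mul (hd 3 x)).const_mul 2)).add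
      ((hd 2 x).mul (hd 2 x))).sub (((hd 0 x).mul (hd 2 x)).const_mul 2)).add
      ((hd 1 x).mul (hd 1 x))
    refine this.congr_deriv ?_
    simp only [iteratedDeriv_zero, Nat.reduceAdd]
    ring
  rw [intervalIntegral.integral_eq_sub_of_hasDerivAt (fun x _ => hF x)]
  · simp only [iteratedDeriv_zero, iteratedDeriv_one, h0, h1, h0', h1', h2]
    have hα2 : α ^ 2 ≤ 1 := by
      rw [← sq_abs]; nlinarith [abs_nonneg α]
    nlinarith [sq_nonneg (iteratedDeriv 2 v 0)]
  · have := hc 5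
    have := hc 3
    have := hv.continuous
    exact Continuous.intervalIntegrable (by fun_prop) _ _

/-- For a classical solution of the damped linear Kawahara system,
the energy at time `T ≥ 0` is bounded by the initial energy. -/
theorem kawahara_energy_decreasing (α : ℝ) (hα : |α| < 1) (u : ℝ → ℝ → ℝ)
    (hu : ContDiff ℝ (⊤ : ℕ∞) (Function.uncurry u))
    (hpde : ∀ x ∈ Set.Icc (0:ℝ) 1, ∀ t : ℝ,
      deriv (u x) t + iteratedDeriv 3 (fun y => u y t) x
        - iteratedDeriv 5 (fun y => u y t) x = 0)
    (hbc0 : ∀ t : ℝ, u 0 t = 0) (hbc1 : ∀ t : ℝ, u 1 t = 0)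
    (hbx0 : ∀ t : ℝ, deriv (fun y => u y t) 0 = 0)
    (hbx1 : ∀ t : ℝ, deriv (fun y => u y t) 1 = 0)
    (hbxx : ∀ t : ℝ, iteratedDeriv 2 (fun y => u y t) 1
      = α * iteratedDeriv 2 (fun y => u y t) 0) :
    ∀ T : ℝ, 0 ≤ T →
      (∫ x in (0:ℝ)..1, (u x T)^2) ≤ ∫ x in (0:ℝ)..1, (u x 0)^2 := by
  intro T hT
  have ht : ∀ x t : ℝ, HasDerivAt (u x) (fderiv ℝ (Function.uncurry u) (x, t) (0, 1)) t := by
    intro x t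
    have h1 : HasDerivAt (fun s : ℝ => (x, s)) ((0 : ℝ), (1 : ℝ)) t :=
      (hasDerivAt_const t x).prodMk (hasDerivAt_id t)
    have h2 : HasFDerivAt (Function.uncurry u) (fderiv ℝ (Function.uncurry u) (x, t)) (x, t) :=
      ((hu.differentiable (by simp)) (x, t)).hasFDerivAt
    exact h2.comp_hasDerivAt t h1
  have hcu : Continuous (Function.uncurry u) := hu.continuous
  have hcd : Continuous fun p : ℝ × ℝ => fderiv ℝ (Function.uncurry u) p (0, 1) :=
    (hu.continuous_fderiv (by simp)).clm_apply continuous_const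
  let g : ℝ → ℝ → ℝ := fun x t => 2 * u x t * fderiv ℝ (Function.uncurry u) (x, t) (0, 1)
  have hg : Continuous (Function.uncurry g) := (continuous_const.mul hcu).mul hcd
  have hgx : ∀ x, Continuous (g x) := fun x => hg.comp (Continuous.prodMk_right x)
  have hux : ∀ t, Continuous fun x => u x t := fun t => hcu.comp (Continuous.prodMk_left t)
  have hft : ∀ x, (∫ t in (0:ℝ)..T, g x t) = (u x T) ^ 2 - (u x 0) ^ 2 := by
    intro x
    refine intervalIntegral.integral_eq_sub_of_hasDerivAt (f := fun t => (u x t) ^ 2) (fun t _ => ?_)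
      ((hgx x).intervalIntegrable _ _)
    refine ((ht x t).pow 2).congr_deriv ?_
    simp [g]
  have hint : ∀ t, IntervalIntegrable (fun x => (u x t) ^ 2) MeasureTheory.volume 0 1 := fun t =>
    ((hux t).pow 2).intervalIntegrable _ _
  rw [← sub_nonpos, ← intervalIntegral.integral_sub (hint T) (hint 0)]
  simp_rw [← hft]
  have hI : MeasureTheory.IntegrableOn (Function.uncurry g)
      (Set.uIoc (0:ℝ) 1 ×ˢ Set.uIoc (0:ℝ) T) MeasureTheory.volume := by
    have hK : MeasureTheory.IntegrableOn (Function.uncurry g)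
        (Set.uIcc (0:ℝ) 1 ×ˢ Set.uIcc (0:ℝ) T) MeasureTheory.volume :=
      hg.continuousOn.integrableOn_compact (isCompact_uIcc.prod isCompact_uIcc)
    exact hK.mono_set (Set.prod_mono Set.uIoc_subset_uIcc Set.uIoc_subset_uIcc)
  rw [MeasureTheory.intervalIntegral_intervalIntegral_swap hI]
  rw [← neg_nonneg, ← intervalIntegral.integral_neg]
  refine intervalIntegral.integral_nonneg hT fun t _ => ?_
  rw [neg_nonneg]
  have hv : ContDiff ℝ (⊤ : ℕ∞) (fun y => u y t) :=
    hu.comp (contDiff_id.prodMk contDiff_const)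
  refine le_of_eq_of_le ?_ (kawahara_space_integral _ hv α hα (hbc0 t) (hbc1 t) (hbx0 t) (hbx1 t)
    (hbxx t))
  refine intervalIntegral.integral_congr fun x hx => ?_
  rw [Set.uIcc_of_le zero_le_one] at hx
  have h := hpde x hx t
  rw [(ht x t).deriv] at h
  simp only [g]
  congr 1
  linarith
end

section
/- Let u be a classical solution of the damped linear Kawahara system. Then for every T ≥ 0 one has (1 − α²)·∫₀ᵀ (∂ₓ²u(0,t))² dt ≤ ∫₀¹ u(x,0)² dx. -/
lemma kaw_dx (f : ℝ → ℝ → ℝ) (hf : ContDiff ℝ (⊤ : ℕ∞) (Function.uncurry f)) :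
    ContDiff ℝ (⊤ : ℕ∞) (Function.uncurry (fun x t => deriv (fun y => f y t) x)) := by
  have h : Function.uncurry (fun x t => deriv (fun y => f y t) x)
      = fun p : ℝ × ℝ => fderiv ℝ (Function.uncurry f) p (1, 0) := by
    funext p
    obtain ⟨x, t⟩ := p
    have h1 : HasFDerivAt (Function.uncurry f) (fderiv ℝ (Function.uncurry f) (x, t)) (x, t) :=
      ((hf.differentiable (by simp)) _).hasFDerivAt
    have h2 : HasDerivAt (fun y : ℝ => (y, t)) ((1 : ℝ), (0 : ℝ)) x :=
      (hasDerivAt_id x).prodMk (hasDerivAt_const x t)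
    exact (h1.comp_hasDerivAt x h2).deriv
  rw [h]
  exact (hf.fderiv_right (by simp)).clm_apply contDiff_const

lemma kaw_dt (f : ℝ → ℝ → ℝ) (hf : ContDiff ℝ (⊤ : ℕ∞) (Function.uncurry f)) :
    ContDiff ℝ (⊤ : ℕ∞) (Function.uncurry (fun x t => deriv (f x) t)) := by
  have h : Function.uncurry (fun x t => deriv (f x) t)
      = fun p : ℝ × ℝ => fderiv ℝ (Function.uncurry f) p (0, 1) := by
    funext p
    obtain ⟨x, t⟩ := p
    have h1 : HasFDerivAt (Function.uncurry f) (fderiv ℝ (Function.uncurry f) (x, t)) (x, t) :=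
      ((hf.differentiable (by simp)) _).hasFDerivAt
    have h2 : HasDerivAt (fun y : ℝ => (x, y)) ((0 : ℝ), (1 : ℝ)) t :=
      (hasDerivAt_const t x).prodMk (hasDerivAt_id t)
    exact (h1.comp_hasDerivAt t h2).deriv
  rw [h]
  exact (hf.fderiv_right (by simp)).clm_apply contDiff_const

lemma kaw_iter (f : ℝ → ℝ → ℝ) (hf : ContDiff ℝ (⊤ : ℕ∞) (Function.uncurry f)) (n : ℕ) :
    ContDiff ℝ (⊤ : ℕ∞) (Function.uncurry (fun x t => iteratedDeriv n (fun y => f y t) x)) := by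
  induction n with
  | zero => simpa using hf
  | succ k ih =>
    simp only [iteratedDeriv_succ]
    exact kaw_dx _ ih

lemma kaw_slice (f : ℝ → ℝ → ℝ) (hf : ContDiff ℝ (⊤ : ℕ∞) (Function.uncurry f)) (t : ℝ) :
    ContDiff ℝ (⊤ : ℕ∞) (fun y => f y t) :=
  hf.comp (contDiff_id.prodMk contDiff_const : ContDiff ℝ (⊤ : ℕ∞) (fun y : ℝ => (y, t)))

lemma kaw_slice' (f : ℝ → ℝ → ℝ) (hf : ContDiff ℝ (⊤ : ℕ∞) (Function.uncurry f)) (x : ℝ) :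
    ContDiff ℝ (⊤ : ℕ∞) (fun t => f x t) :=
  hf.comp (contDiff_const.prodMk contDiff_id : ContDiff ℝ (⊤ : ℕ∞) (fun t : ℝ => (x, t)))

lemma kaw_hd (g : ℝ → ℝ) (hg : ContDiff ℝ (⊤ : ℕ∞) g) (n : ℕ) (x : ℝ) :
    HasDerivAt (iteratedDeriv n g) (iteratedDeriv (n+1) g x) x := by
  rw [iteratedDeriv_succ]
  exact ((hg.differentiable_iteratedDeriv n (by exact_mod_cast WithTop.coe_lt_top _)) x).hasDerivAt


/-- For a classical solution of the damped linear Kawahara system,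
`(1 - α²) ∫₀ᵀ (∂ₓ²u(0,t))² dt ≤ ∫₀¹ u(x,0)² dx` for every `T ≥ 0`. -/
theorem kawahara_trace_estimate (α : ℝ) (hα : |α| < 1) (u : ℝ → ℝ → ℝ)
    (hu : ContDiff ℝ (⊤ : ℕ∞) (Function.uncurry u))
    (hpde : ∀ x ∈ Set.Icc (0:ℝ) 1, ∀ t : ℝ,
      deriv (u x) t + iteratedDeriv 3 (fun y => u y t) x
        - iteratedDeriv 5 (fun y => u y t) x = 0)
    (hbc0 : ∀ t : ℝ, u 0 t = 0) (hbc1 : ∀ t : ℝ, u 1 t = 0)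
    (hbx0 : ∀ t : ℝ, deriv (fun y => u y t) 0 = 0)
    (hbx1 : ∀ t : ℝ, deriv (fun y => u y t) 1 = 0)
    (hbxx : ∀ t : ℝ, iteratedDeriv 2 (fun y => u y t) 1
      = α * iteratedDeriv 2 (fun y => u y t) 0) :
    ∀ T : ℝ, 0 ≤ T →
      (1 - α^2) * (∫ t in (0:ℝ)..T, (iteratedDeriv 2 (fun y => u y t) 0)^2)
        ≤ ∫ x in (0:ℝ)..1, (u x 0)^2 := by
  intro T hT
  have key : ∀ t, (∫ x in (0:ℝ)..1, 2 * u x t * deriv (u x) t)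
      = (α^2 - 1) * (iteratedDeriv 2 (fun y => u y t) 0)^2 := by
    intro t
    set g : ℝ → ℝ := fun y => u y t with hg
    have gs : ContDiff ℝ (⊤ : ℕ∞) g := kaw_slice u hu t
    have d0 : ∀ x, HasDerivAt g (iteratedDeriv 1 g x) x := by
      intro x
      simpa using kaw_hd g gs 0 x
    have d := kaw_hd g gs
    have b0 : iteratedDeriv 1 g 0 = 0 := by rw [iteratedDeriv_one]; exact hbx0 t
    have b1 : iteratedDeriv 1 g 1 = 0 := by rw [iteratedDeriv_one]; exact hbx1 t
    have c0 : g 0 = 0 := hbc0 t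
    have c1 : g 1 = 0 := hbc1 t
    have c2 : iteratedDeriv 2 g 1 = α * iteratedDeriv 2 g 0 := hbxx t
    have hc : Continuous (fun x => 2 * u x t * deriv (u x) t) :=
      (continuous_const.mul gs.continuous).mul (kaw_slice _ (kaw_dt u hu) t).continuous
    have := intervalIntegral.integral_eq_sub_of_hasDerivAt (a := 0) (b := 1)
      (f := fun x => 2 * (g x * iteratedDeriv 4 g x - iteratedDeriv 1 g x * iteratedDeriv 3 g x)
        + iteratedDeriv 2 g x ^ 2 - 2 * (g x * iteratedDeriv 2 g x) + iteratedDeriv 1 g x ^ 2)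
      (f' := fun x => 2 * u x t * deriv (u x) t) (by
        intro x hx
        rw [Set.uIcc_of_le zero_le_one] at hx
        have hp : deriv (u x) t + iteratedDeriv 3 g x - iteratedDeriv 5 g x = 0 := hpde x hx t
        have e : deriv (u x) t = iteratedDeriv 5 g x - iteratedDeriv 3 g x := by linarith
        rw [e]
        have := ((((((d0 x).mul (d 4 x)).sub ((d 1 x).mul (d 3 x))).const_mul 2).add
          ((d 2 x).pow 2)).sub (((d0 x).mul (d 2 x)).const_mul 2)).add ((d 1 x).pow 2)
        refine this.congr_deriv ?_
        change _ = 2 * g x * (iteratedDeriv 5 g x - iteratedDeriv 3 g x)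
        norm_num
        ring) (hc.intervalIntegrable _ _)
    rw [this, b0, b1, c0, c1, c2]
    ring
  have ft : ∀ x, (∫ t in (0:ℝ)..T, 2 * u x t * deriv (u x) t) = u x T ^ 2 - u x 0 ^ 2 := by
    intro x
    have hs := kaw_slice' u hu x
    refine intervalIntegral.integral_eq_sub_of_hasDerivAt (f := fun t => u x t ^ 2) ?_ ?_
    · intro t _
      have := ((hs.differentiable (by simp)) t).hasDerivAt.pow 2
      refine this.congr_deriv ?_
      norm_num
    · exact Continuous.intervalIntegrable ((continuous_const.mul hs.continuous).mul
        (kaw_slice' _ (kaw_dt u hu) x).continuous) _ _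
  have hc2 : Continuous (Function.uncurry (fun x t => 2 * u x t * deriv (u x) t)) :=
    (continuous_const.mul hu.continuous).mul (kaw_dt u hu).continuous
  have swap : (∫ x in (0:ℝ)..1, ∫ t in (0:ℝ)..T, 2 * u x t * deriv (u x) t)
      = ∫ t in (0:ℝ)..T, ∫ x in (0:ℝ)..1, 2 * u x t * deriv (u x) t := by
    simp only [intervalIntegral.integral_of_le hT, intervalIntegral.integral_of_le zero_le_one]
    apply MeasureTheory.integral_integral_swap
    rw [MeasureTheory.Measure.prod_restrict]
    have hi : MeasureTheory.IntegrableOn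
        (Function.uncurry (fun x t => 2 * u x t * deriv (u x) t))
        (Set.Icc (0:ℝ) 1 ×ˢ Set.Icc 0 T) (MeasureTheory.volume.prod MeasureTheory.volume) :=
      hc2.continuousOn.integrableOn_compact (isCompact_Icc.prod isCompact_Icc)
    exact hi.mono_set (Set.prod_mono Set.Ioc_subset_Icc_self Set.Ioc_subset_Icc_self)
  simp only [key, ft] at swap
  have hq : ∀ t, Continuous (fun x => u x t ^ 2) := fun t => (kaw_slice u hu t).continuous.pow 2
  rw [intervalIntegral.integral_const_mul, intervalIntegral.integral_sub
    ((hq T).intervalIntegrable _ _)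
    ((hq 0).intervalIntegrable _ _)] at swap
  have pos : 0 ≤ ∫ x in (0:ℝ)..1, (u x T)^2 :=
    intervalIntegral.integral_nonneg zero_le_one (fun x _ => sq_nonneg _)
  linarith
end

section
/- Let α ∈ ℝ with |α| < 1 and let f : ℝ → ℝ be five times continuously differentiable on a neighbourhood of [0,1], satisfying f(0) = f(1) = f'(0) = f'(1) = 0 and f''(1) = α·f''(0). Then 2·∫₀¹ x·f(x)·(f⁽⁵⁾(x) − f'''(x)) dx ≤ ∫₀¹ f(x)² dx − 3·∫₀¹ (f'(x))² dx − 5·∫₀¹ (f''(x))² dx + α²·(f''(0))². -/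
/-- The `xu`-multiplier estimate: for `f` five times continuously
differentiable on a neighbourhood of `[0,1]` satisfying the Kawahara boundary
conditions with `|α| < 1`, one has
`2∫₀¹ x f (f⁽⁵⁾ - f''') ≤ ∫₀¹ f² - 3∫₀¹ f'² - 5∫₀¹ f''² + α² f''(0)²`. -/
theorem kawahara_xu_multiplier (α : ℝ) (hα : |α| < 1) (f : ℝ → ℝ)
    (s : Set ℝ) (hs : IsOpen s) (hsub : Set.Icc (0:ℝ) 1 ⊆ s)
    (hf : ContDiffOn ℝ 5 f s)
    (h0 : f 0 = 0) (h1 : f 1 = 0)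
    (hd0 : deriv f 0 = 0) (hd1 : deriv f 1 = 0)
    (hdd : iteratedDeriv 2 f 1 = α * iteratedDeriv 2 f 0) :
    2 * (∫ x in (0:ℝ)..1, x * f x * (iteratedDeriv 5 f x - iteratedDeriv 3 f x))
      ≤ (∫ x in (0:ℝ)..1, (f x)^2) - 3 * (∫ x in (0:ℝ)..1, (deriv f x)^2)
        - 5 * (∫ x in (0:ℝ)..1, (iteratedDeriv 2 f x)^2)
        + α^2 * (iteratedDeriv 2 f 0)^2 := by
  have hD : ∀ n : ℕ, n < 5 → ∀ x ∈ Set.Icc (0:ℝ) 1,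
      HasDerivAt (iteratedDeriv n f) (iteratedDeriv (n+1) f x) x := by
    intro n hn x hx
    have h := hf.differentiableOn_iteratedDerivWithin (m := n) (by exact_mod_cast hn)
      hs.uniqueDiffOn
    have hd : DifferentiableAt ℝ (iteratedDeriv n f) x :=
      (h.congr (fun y hy => (iteratedDerivWithin_of_isOpen hs hy).symm)).differentiableAt
        (hs.mem_nhds (hsub hx))
    rw [iteratedDeriv_succ]
    exact hd.hasDerivAt
  have hC : ∀ n : ℕ, n ≤ 5 → ContinuousOn (iteratedDeriv n f) (Set.Icc (0:ℝ) 1) := by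
    intro n hn
    have h := hf.continuousOn_iteratedDerivWithin (m := n) (by exact_mod_cast hn) hs.uniqueDiffOn
    refine (h.congr ?_).mono hsub
    intro x hx
    exact (iteratedDerivWithin_of_isOpen hs hx).symm
  have c0 := hC 0 (by norm_num)
  have c1 := hC 1 (by norm_num)
  have c2 := hC 2 (by norm_num)
  have c3 := hC 3 (by norm_num)
  have c5 := hC 5 (by norm_num)
  have d0 := hD 0 (by norm_num)
  have d1 := hD 1 (by norm_num)
  have d2 := hD 2 (by norm_num)
  have d3 := hD 3 (by norm_num)
  have d4 := hD 4 (by norm_num)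
  simp only [Nat.reduceAdd, iteratedDeriv_zero, iteratedDeriv_one] at c0 c1 d0 d1 d2 d3 d4
  generalize deriv f = f1 at *
  generalize iteratedDeriv 2 f = f2 at *
  generalize iteratedDeriv 3 f = f3 at *
  generalize iteratedDeriv 4 f = f4 at *
  generalize iteratedDeriv 5 f = f5 at *
  have hI : ∀ g : ℝ → ℝ, ContinuousOn g (Set.Icc 0 1) →
      IntervalIntegrable g MeasureTheory.volume 0 1 := by
    intro g hg
    apply ContinuousOn.intervalIntegrable
    rwa [Set.uIcc_of_le zero_le_one]
  have i0 := hI (fun x => x * f x * (f5 x - f3 x)) (by fun_prop)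
  have i1 := hI (fun x => (f1 x)^2) (by fun_prop)
  have i2 := hI (fun x => (f2 x)^2) (by fun_prop)
  have key : ∫ x in (0:ℝ)..1, (2 * (x * f x * (f5 x - f3 x)) + 3 * (f1 x)^2 + 5 * (f2 x)^2)
      = f2 1 ^ 2 := by
    have := intervalIntegral.integral_eq_sub_of_hasDerivAt (a := 0) (b := 1)
      (f := fun x => 2 * (x * f x * f4 x - (f x + x * f1 x) * f3 x + (2 * f1 x + x * f2 x) * f2 x
        - x * (f2 x * f2 x) / 2) - 2 * (x * f x * f2 x - f x * f1 x - x * (f1 x * f1 x) / 2))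
      (f' := fun x => 2 * (x * f x * (f5 x - f3 x)) + 3 * (f1 x)^2 + 5 * (f2 x)^2)
      ?_ (((i0.const_mul 2).add (i1.const_mul 3)).add (i2.const_mul 5))
    · rw [this]
      simp only [h0, h1, hd0, hd1]
      ring
    · intro x hx
      rw [Set.uIcc_of_le zero_le_one] at hx
      have e0 := d0 x hx
      have e1 := d1 x hx
      have e2 := d2 x hx
      have e3 := d3 x hx
      have e4 := d4 x hx
      have ex := hasDerivAt_id' x
      refine (((((((ex.mul e0).mul e4).sub ((e0.add (ex.mul e1)).mul e3)).add
        (((e1.const_mul 2).add (ex.mul e2)).mul e2)).sub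
        ((ex.mul (e2.mul e2)).div_const 2)).const_mul 2).sub
        (((((ex.mul e0).mul e2).sub (e0.mul e1)).sub
        ((ex.mul (e1.mul e1)).div_const 2)).const_mul 2)).congr_deriv ?_
      simp only [Pi.mul_apply, Pi.add_apply]
      ring
  rw [intervalIntegral.integral_add ((i0.const_mul 2).add (i1.const_mul 3)) (i2.const_mul 5),
    intervalIntegral.integral_add (i0.const_mul 2) (i1.const_mul 3),
    intervalIntegral.integral_const_mul, intervalIntegral.integral_const_mul,
    intervalIntegral.integral_const_mul, hdd, mul_pow] at key
  have hpos : 0 ≤ ∫ x in (0:ℝ)..1, (f x)^2 :=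
    intervalIntegral.integral_nonneg zero_le_one (fun x _ => sq_nonneg _)
  linarith
end

section
/- Let u be a classical solution of the damped linear Kawahara system. Then for every T > 0 one has ∫₀ᵀ ∫₀¹ ( u(x,t)² + (∂ₓu(x,t))² + (∂ₓ²u(x,t))² ) dx dt ≤ (1/3)·( 1/(1 − α²) + 4T )·∫₀¹ u(x,0)² dx. -/
theorem kaw_smooth (u : ℝ → ℝ → ℝ) (hu : ContDiff ℝ (⊤ : ℕ∞) (Function.uncurry u)) (k : ℕ) :
    ContDiff ℝ (⊤ : ℕ∞) (fun p : ℝ × ℝ => iteratedDeriv k (fun y => u y p.2) p.1) := by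
  induction k with
  | zero => simpa [Function.uncurry_def] using hu
  | succ k ih =>
    simp only [iteratedDeriv_succ, ← fderiv_apply_one_eq_deriv]
    refine ContDiff.fderiv_apply (m := (⊤ : ℕ∞)) (n := (⊤ : ℕ∞))
      (f := fun (p : ℝ × ℝ) (x : ℝ) => iteratedDeriv k (fun y => u y p.2) x) ?_ contDiff_fst
      contDiff_const (by simp)
    exact ih.comp (contDiff_snd.prodMk (contDiff_snd.comp contDiff_fst))

theorem kaw_smooth_t (u : ℝ → ℝ → ℝ) (hu : ContDiff ℝ (⊤ : ℕ∞) (Function.uncurry u)) :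
    ContDiff ℝ (⊤ : ℕ∞) (fun p : ℝ × ℝ => deriv (u p.1) p.2) := by
  simp only [← fderiv_apply_one_eq_deriv]
  refine ContDiff.fderiv_apply (m := (⊤ : ℕ∞)) (n := (⊤ : ℕ∞))
    (f := fun (p : ℝ × ℝ) (x : ℝ) => u p.1 x) ?_ contDiff_snd
    contDiff_const (by simp)
  exact hu.comp ((contDiff_fst.comp contDiff_fst).prodMk contDiff_snd)

theorem kaw_hasDeriv (u : ℝ → ℝ → ℝ) (hu : ContDiff ℝ (⊤ : ℕ∞) (Function.uncurry u)) (k : ℕ)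
    (x t : ℝ) : HasDerivAt (fun x => iteratedDeriv k (fun y => u y t) x)
      (iteratedDeriv (k+1) (fun y => u y t) x) x := by
  rw [iteratedDeriv_succ]
  have h : ContDiff ℝ (⊤ : ℕ∞) (fun x => iteratedDeriv k (fun y => u y t) x) :=
    (kaw_smooth u hu k).comp (contDiff_id.prodMk contDiff_const)
  exact (h.differentiable (by simp) x).hasDerivAt

theorem kaw_hasDeriv_t (u : ℝ → ℝ → ℝ) (hu : ContDiff ℝ (⊤ : ℕ∞) (Function.uncurry u))
    (x t : ℝ) : HasDerivAt (u x) (deriv (u x) t) t := by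
  have h : ContDiff ℝ (⊤ : ℕ∞) (u x) := hu.comp (contDiff_const.prodMk contDiff_id)
  exact (h.differentiable (by simp) t).hasDerivAt

/-- Integrated energy identity with a space weight. -/
theorem kaw_energy (u : ℝ → ℝ → ℝ) (hu : ContDiff ℝ (⊤ : ℕ∞) (Function.uncurry u))
    (w : ℝ → ℝ) (hw : Continuous w) (T : ℝ) :
    (∫ x in (0:ℝ)..1, w x * (u x T)^2) - (∫ x in (0:ℝ)..1, w x * (u x 0)^2)
      = ∫ t in (0:ℝ)..T, ∫ x in (0:ℝ)..1, 2 * w x * u x t * deriv (u x) t := by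
  have hc : Continuous (fun p : ℝ × ℝ => u p.1 p.2) := hu.continuous
  have hct : Continuous (fun p : ℝ × ℝ => deriv (u p.1) p.2) := (kaw_smooth_t u hu).continuous
  have hF : Continuous (fun p : ℝ × ℝ => 2 * w p.2 * u p.2 p.1 * deriv (u p.2) p.1) :=
    ((continuous_const.mul (hw.comp continuous_snd)).mul (hc.comp continuous_swap)).mul
      (hct.comp continuous_swap)
  have hx : ∀ s, Continuous (fun x => w x * (u x s)^2) := fun s =>
    hw.mul ((hc.comp (continuous_id.prodMk continuous_const)).pow 2)
  rw [MeasureTheory.intervalIntegral_intervalIntegral_swap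
    (F := fun t x => 2 * w x * u x t * deriv (u x) t),
    ← intervalIntegral.integral_sub ((hx T).intervalIntegrable _ _)
      ((hx 0).intervalIntegrable _ _)]
  · refine intervalIntegral.integral_congr fun x _ => ?_
    symm
    refine intervalIntegral.integral_eq_sub_of_hasDerivAt (f := fun t => w x * (u x t)^2) ?_ ?_
    · intro t _
      have := ((kaw_hasDeriv_t u hu x t).pow 2).const_mul (w x)
      refine this.congr_deriv ?_
      simp; ring
    · exact (hF.comp (continuous_id.prodMk continuous_const)).intervalIntegrable _ _
  · refine (hF.continuousOn.integrableOn_compact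
      (isCompact_uIcc.prod isCompact_uIcc)).mono_set
      (Set.prod_mono Set.uIoc_subset_uIcc Set.uIoc_subset_uIcc)


/-- Space-time `H²` estimate for classical solutions of the damped linear
Kawahara system. -/
theorem kawahara_H2_spacetime_estimate (α : ℝ) (hα : |α| < 1) (u : ℝ → ℝ → ℝ)
    (hu : ContDiff ℝ (⊤ : ℕ∞) (Function.uncurry u))
    (hpde : ∀ x ∈ Set.Icc (0:ℝ) 1, ∀ t : ℝ,
      deriv (u x) t + iteratedDeriv 3 (fun y => u y t) x
        - iteratedDeriv 5 (fun y => u y t) x = 0)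
    (hbc0 : ∀ t : ℝ, u 0 t = 0) (hbc1 : ∀ t : ℝ, u 1 t = 0)
    (hbx0 : ∀ t : ℝ, deriv (fun y => u y t) 0 = 0)
    (hbx1 : ∀ t : ℝ, deriv (fun y => u y t) 1 = 0)
    (hbxx : ∀ t : ℝ, iteratedDeriv 2 (fun y => u y t) 1
      = α * iteratedDeriv 2 (fun y => u y t) 0) :
    ∀ T : ℝ, 0 < T →
      (∫ t in (0:ℝ)..T, ∫ x in (0:ℝ)..1,
          ((u x t)^2 + (deriv (fun y => u y t) x)^2
            + (iteratedDeriv 2 (fun y => u y t) x)^2))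
        ≤ (1/3) * (1/(1 - α^2) + 4*T) * ∫ x in (0:ℝ)..1, (u x 0)^2 := by
  intro T hT
  have h2 : 0 < 1 - α^2 := by
    have := (sq_lt_one_iff_abs_lt_one α).2 hα
    linarith
  have hD := fun k t x => kaw_hasDeriv u hu k x t
  have hcv : ∀ k, Continuous (fun p : ℝ × ℝ => iteratedDeriv k (fun y => u y p.2) p.1) :=
    fun k => (kaw_smooth u hu k).continuous
  obtain ⟨v, hv⟩ : ∃ v : ℕ → ℝ → ℝ → ℝ, v = fun k x t => iteratedDeriv k (fun y => u y t) x :=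
    ⟨_, rfl⟩
  have hv0 : ∀ x t, u x t = v 0 x t := by intro x t; simp [hv]
  have hv1 : ∀ x t, deriv (fun y => u y t) x = v 1 x t := by intro x t; simp [hv]
  have hvk : ∀ k x t, iteratedDeriv k (fun y => u y t) x = v k x t := by intro k x t; simp [hv]
  have hE := fun w hw s => kaw_energy u hu w hw s
  simp only [hv1] at hbx0 hbx1
  simp only [hvk] at hpde hbxx hD hcv
  have hut : ∀ x ∈ Set.uIcc (0:ℝ) 1, ∀ t, deriv (u x) t = v 5 x t - v 3 x t := by
    intro x hx t
    rw [Set.uIcc_of_le zero_le_one] at hx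
    linarith [hpde x hx t]
  simp only [hv1, hvk]
  simp only [hv0] at hbc0 hbc1
  have hE' : ∀ w : ℝ → ℝ, Continuous w → ∀ s,
      (∫ x in (0:ℝ)..1, w x * (v 0 x s)^2) - (∫ x in (0:ℝ)..1, w x * (v 0 x 0)^2)
      = ∫ t in (0:ℝ)..s, ∫ x in (0:ℝ)..1, 2 * w x * v 0 x t * (v 5 x t - v 3 x t) := by
    intro w hw s
    have := hE w hw s
    simp only [← hv0]
    rw [this]
    refine intervalIntegral.integral_congr fun t _ => ?_
    refine intervalIntegral.integral_congr fun x hx => ?_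
    simp only [hut x hx t]
  simp only [hv0]
  have hD' : ∀ k t x, HasDerivAt (fun x => v k x t) (v (k+1) x t) x := hD
  have hcx : ∀ k t, Continuous (fun x => v k x t) := fun k t =>
    (hcv k).comp (continuous_id.prodMk continuous_const)
  have hcs : ∀ k x, Continuous (fun t => v k x t) := fun k x =>
    (hcv k).comp (continuous_const.prodMk continuous_id)
  clear hE hut hpde hv0 hv1 hvk hD hv
  -- continuity of the inner integrals
  have hcI : ∀ k, Continuous (fun t => ∫ x in (0:ℝ)..1, (v k x t)^2) := fun k =>
    intervalIntegral.continuous_parametric_intervalIntegral_of_continuous'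
      (f := fun t x => (v k x t)^2) (by
        have := (hcv k).comp continuous_swap
        exact this.pow 2) 0 1
  -- energy identity
  have hA : ∀ t, ∫ x in (0:ℝ)..1, 2 * 1 * v 0 x t * (v 5 x t - v 3 x t)
      = -(1 - α^2) * (v 2 0 t)^2 := by
    intro t
    have h0 := hcx 0 t
    have h3 := hcx 3 t
    have h5 := hcx 5 t
    rw [intervalIntegral.integral_eq_sub_of_hasDerivAt (f := fun x =>
      2 * (v 0 x t * v 4 x t) - 2 * (v 1 x t * v 3 x t) + (v 2 x t)^2
        - 2 * (v 0 x t * v 2 x t) + (v 1 x t)^2)]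
    · simp only [hbc0, hbc1, hbx0, hbx1, hbxx]; ring
    · intro x _
      have := (((((((hD' 0 t x).mul (hD' 4 t x)).const_mul 2).sub
        (((hD' 1 t x).mul (hD' 3 t x)).const_mul 2)).add ((hD' 2 t x).pow 2)).sub
        (((hD' 0 t x).mul (hD' 2 t x)).const_mul 2)).add ((hD' 1 t x).pow 2))
      refine this.congr_deriv ?_
      norm_num; ring
    · exact Continuous.intervalIntegrable (by fun_prop) _ _
  have hB : ∀ t, ∫ x in (0:ℝ)..1, 2 * x * v 0 x t * (v 5 x t - v 3 x t)
      = α^2 * (v 2 0 t)^2 - 5 * (∫ x in (0:ℝ)..1, (v 2 x t)^2)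
        - 3 * (∫ x in (0:ℝ)..1, (v 1 x t)^2) := by
    intro t
    have h0 := hcx 0 t
    have h1 := hcx 1 t
    have h2 := hcx 2 t
    have h3 := hcx 3 t
    have h5 := hcx 5 t
    have key : ∫ x in (0:ℝ)..1, (2 * x * v 0 x t * (v 5 x t - v 3 x t)
        + 5 * (v 2 x t)^2 + 3 * (v 1 x t)^2) = α^2 * (v 2 0 t)^2 := by
      rw [intervalIntegral.integral_eq_sub_of_hasDerivAt (f := fun x =>
        x * (2 * (v 0 x t * v 4 x t) - 2 * (v 1 x t * v 3 x t) + (v 2 x t)^2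
        - 2 * (v 0 x t * v 2 x t) + (v 1 x t)^2)
        + (4 * (v 1 x t * v 2 x t) - 2 * (v 0 x t * v 3 x t) + 2 * (v 0 x t * v 1 x t)))]
      · simp only [hbc0, hbc1, hbx0, hbx1, hbxx]; ring
      · intro x _
        have := (((((((hD' 0 t x).mul (hD' 4 t x)).const_mul 2).sub
          (((hD' 1 t x).mul (hD' 3 t x)).const_mul 2)).add ((hD' 2 t x).pow 2)).sub
          (((hD' 0 t x).mul (hD' 2 t x)).const_mul 2)).add ((hD' 1 t x).pow 2))
        have := ((hasDerivAt_id x).mul this).add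
          (((((hD' 1 t x).mul (hD' 2 t x)).const_mul 4).sub
          (((hD' 0 t x).mul (hD' 3 t x)).const_mul 2)).add
          (((hD' 0 t x).mul (hD' 1 t x)).const_mul 2))
        refine this.congr_deriv ?_
        norm_num; ring
      · exact Continuous.intervalIntegrable (by fun_prop) _ _
    rw [intervalIntegral.integral_add (Continuous.intervalIntegrable (by fun_prop) _ _)
      (Continuous.intervalIntegrable (by fun_prop) _ _),
      intervalIntegral.integral_add (Continuous.intervalIntegrable (by fun_prop) _ _)
      (Continuous.intervalIntegrable (by fun_prop) _ _),
      intervalIntegral.integral_const_mul, intervalIntegral.integral_const_mul] at key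
    linarith
  have hE1 : ∀ s, (∫ x in (0:ℝ)..1, (v 0 x s)^2) - (∫ x in (0:ℝ)..1, (v 0 x 0)^2)
      = -(1 - α^2) * ∫ t in (0:ℝ)..s, (v 2 0 t)^2 := by
    intro s
    have := hE' (fun _ => 1) continuous_const s
    simp only [hA, one_mul] at this
    rwa [intervalIntegral.integral_const_mul] at this
  have hc20 := hcs 2 0
  have hc1 := hcI 1
  have hc2 := hcI 2
  have hc0 := hcI 0
  have hEx := hE' (fun x => x) continuous_id T
  simp only [hB] at hEx
  rw [intervalIntegral.integral_sub (Continuous.intervalIntegrable (by fun_prop) _ _)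
      (Continuous.intervalIntegrable (by fun_prop) _ _),
    intervalIntegral.integral_sub (Continuous.intervalIntegrable (by fun_prop) _ _)
      (Continuous.intervalIntegrable (by fun_prop) _ _),
    intervalIntegral.integral_const_mul, intervalIntegral.integral_const_mul,
    intervalIntegral.integral_const_mul] at hEx
  have hnn : ∀ s, 0 ≤ s → 0 ≤ ∫ t in (0:ℝ)..s, (v 2 0 t)^2 := fun s hs =>
    intervalIntegral.integral_nonneg hs fun t _ => sq_nonneg _
  have hsplit : (∫ t in (0:ℝ)..T, ∫ x in (0:ℝ)..1,
      ((v 0 x t)^2 + (v 1 x t)^2 + (v 2 x t)^2))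
      = (∫ t in (0:ℝ)..T, ∫ x in (0:ℝ)..1, (v 0 x t)^2)
        + (∫ t in (0:ℝ)..T, ∫ x in (0:ℝ)..1, (v 1 x t)^2)
        + (∫ t in (0:ℝ)..T, ∫ x in (0:ℝ)..1, (v 2 x t)^2) := by
    rw [← intervalIntegral.integral_add (hc0.intervalIntegrable _ _) (hc1.intervalIntegrable _ _),
      ← intervalIntegral.integral_add (Continuous.intervalIntegrable (by fun_prop) _ _)
        (hc2.intervalIntegrable _ _)]
    refine intervalIntegral.integral_congr fun t _ => ?_
    have h0 := hcx 0 t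
    have h1 := hcx 1 t
    have h2 := hcx 2 t
    rw [intervalIntegral.integral_add (Continuous.intervalIntegrable (by fun_prop) _ _)
      (Continuous.intervalIntegrable (by fun_prop) _ _),
      intervalIntegral.integral_add (Continuous.intervalIntegrable (by fun_prop) _ _)
      (Continuous.intervalIntegrable (by fun_prop) _ _)]
  have hI0 : (∫ t in (0:ℝ)..T, ∫ x in (0:ℝ)..1, (v 0 x t)^2)
      ≤ T * ∫ x in (0:ℝ)..1, (v 0 x 0)^2 := by
    have : (∫ t in (0:ℝ)..T, ∫ x in (0:ℝ)..1, (v 0 x t)^2)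
        ≤ ∫ t in (0:ℝ)..T, ∫ x in (0:ℝ)..1, (v 0 x 0)^2 := by
      refine intervalIntegral.integral_mono_on hT.le (hc0.intervalIntegrable _ _)
        (continuous_const.intervalIntegrable _ _) fun t ht => ?_
      nlinarith [hE1 t, mul_nonneg h2.le (hnn t ht.1)]
    simpa using this
  have hpos : ∀ k s, 0 ≤ ∫ x in (0:ℝ)..1, (v k x s)^2 := fun k s =>
    intervalIntegral.integral_nonneg zero_le_one fun t _ => sq_nonneg _
  have hI2 : 0 ≤ ∫ t in (0:ℝ)..T, ∫ x in (0:ℝ)..1, (v 2 x t)^2 :=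
    intervalIntegral.integral_nonneg hT.le fun t _ => hpos 2 t
  have hxT : 0 ≤ ∫ x in (0:ℝ)..1, x * (v 0 x T)^2 :=
    intervalIntegral.integral_nonneg zero_le_one fun x hx => mul_nonneg hx.1 (sq_nonneg _)
  have hx0 : (∫ x in (0:ℝ)..1, x * (v 0 x 0)^2) ≤ ∫ x in (0:ℝ)..1, (v 0 x 0)^2 := by
    have h0 := hcx 0 0
    refine intervalIntegral.integral_mono_on zero_le_one
      (Continuous.intervalIntegrable (by fun_prop) _ _)
      (Continuous.intervalIntegrable (by fun_prop) _ _) fun x hx => ?_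
    nlinarith [hx.2, sq_nonneg (v 0 x 0)]
  rw [hsplit]
  have hET := hE1 T
  have hp0 := hpos 0 0
  have hpT := hpos 0 T
  have hnT := hnn T hT.le
  generalize (∫ x in (0:ℝ)..1, (v 0 x 0)^2) = E0 at *
  generalize (∫ x in (0:ℝ)..1, (v 0 x T)^2) = ET at *
  generalize (∫ t in (0:ℝ)..T, (v 2 0 t)^2) = J at *
  have hJ : J ≤ E0 / (1 - α^2) := by
    rw [le_div_iff₀ h2]; nlinarith
  have hk : α^2 * J + E0 ≤ E0 / (1 - α^2) := by
    have h3 : α^2 * J ≤ α^2 * (E0 / (1 - α^2)) := mul_le_mul_of_nonneg_left hJ (sq_nonneg α)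
    have h4 : α^2 * (E0 / (1 - α^2)) + E0 = E0 / (1 - α^2) := by
      field_simp; ring
    linarith
  have h5 : (1/3) * (1/(1 - α^2) + 4*T) * E0 = (1/3) * (E0 / (1 - α^2)) + 4/3 * (T * E0) := by
    ring
  have h6 : 0 ≤ T * E0 := mul_nonneg hT.le hp0
  rw [h5]
  linarith
end

section
/- Let u be a classical solution of the damped linear Kawahara system. Then for every T > 0 one has (1/2)·∫₀¹ u(x,0)² dx ≤ (1/(2T))·∫₀ᵀ ∫₀¹ u(x,t)² dx dt + ((1 − α²)/2)·∫₀ᵀ (∂ₓ²u(0,t))² dt (weak observability inequality). -/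
lemma kw_dx (v : ℝ → ℝ → ℝ) (hv : ContDiff ℝ (⊤ : ℕ∞) (Function.uncurry v)) :
    ContDiff ℝ (⊤ : ℕ∞) (Function.uncurry (fun x t => deriv (fun y => v y t) x)) := by
  have h : (Function.uncurry (fun x t => deriv (fun y => v y t) x))
      = fun p : ℝ × ℝ => fderiv ℝ (Function.uncurry v) p (1, 0) := by
    funext p
    obtain ⟨x, t⟩ := p
    have h1 : HasFDerivAt (Function.uncurry v) (fderiv ℝ (Function.uncurry v) (x, t)) (x, t) :=
      (hv.differentiable (by simp) (x, t)).hasFDerivAt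
    have h2 : HasDerivAt (fun y : ℝ => (y, t)) ((1 : ℝ), (0 : ℝ)) x :=
      (hasDerivAt_id x).prodMk (hasDerivAt_const x t)
    exact (h1.comp_hasDerivAt x h2).deriv
  rw [h]
  exact (hv.fderiv_right (m := (⊤ : ℕ∞)) (by simp)).clm_apply contDiff_const

lemma kw_dt (v : ℝ → ℝ → ℝ) (hv : ContDiff ℝ (⊤ : ℕ∞) (Function.uncurry v)) :
    Continuous (Function.uncurry (fun x t => deriv (v x) t)) := by
  have h : (Function.uncurry (fun x t => deriv (v x) t))
      = fun p : ℝ × ℝ => fderiv ℝ (Function.uncurry v) p (0, 1) := by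
    funext p
    obtain ⟨x, t⟩ := p
    have h1 : HasFDerivAt (Function.uncurry v) (fderiv ℝ (Function.uncurry v) (x, t)) (x, t) :=
      (hv.differentiable (by simp) (x, t)).hasFDerivAt
    have h2 : HasDerivAt (fun y : ℝ => (x, y)) ((0 : ℝ), (1 : ℝ)) t :=
      (hasDerivAt_const t x).prodMk (hasDerivAt_id t)
    exact (h1.comp_hasDerivAt t h2).deriv
  rw [h]
  exact ((hv.fderiv_right (m := (⊤ : ℕ∞)) (by simp)).clm_apply contDiff_const).continuous

lemma kw_iter (v : ℝ → ℝ → ℝ) (hv : ContDiff ℝ (⊤ : ℕ∞) (Function.uncurry v)) (k : ℕ) :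
    ContDiff ℝ (⊤ : ℕ∞) (Function.uncurry (fun x t => iteratedDeriv k (fun y => v y t) x)) := by
  induction k with
  | zero => simpa using hv
  | succ k ih => simpa only [iteratedDeriv_succ] using kw_dx _ ih

lemma kw_space (α : ℝ) (f : ℝ → ℝ) (hf : ContDiff ℝ (⊤ : ℕ∞) f) (h0 : f 0 = 0) (h1 : f 1 = 0)
    (hd0 : deriv f 0 = 0) (hd1 : deriv f 1 = 0)
    (h2 : iteratedDeriv 2 f 1 = α * iteratedDeriv 2 f 0) :
    ∫ x in (0:ℝ)..1, 2 * f x * (iteratedDeriv 5 f x - iteratedDeriv 3 f x)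
      = (α ^ 2 - 1) * (iteratedDeriv 2 f 0) ^ 2 := by
  have hD : ∀ k x, HasDerivAt (iteratedDeriv k f) (iteratedDeriv (k+1) f x) x := by
    intro k x
    rw [iteratedDeriv_succ]
    exact (hf.differentiable_iteratedDeriv k (by exact_mod_cast WithTop.coe_lt_top _) x).hasDerivAt
  have hc : ∀ k, Continuous (iteratedDeriv k f) := fun k =>
    hf.continuous_iteratedDeriv k (by exact_mod_cast le_top)
  have e0 : iteratedDeriv 0 f = f := iteratedDeriv_zero
  have e1 : iteratedDeriv 1 f = deriv f := iteratedDeriv_one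
  have key := intervalIntegral.integral_eq_sub_of_hasDerivAt (a := 0) (b := 1)
    (f := fun x => 2 * (iteratedDeriv 0 f x * iteratedDeriv 4 f x
      - iteratedDeriv 1 f x * iteratedDeriv 3 f x - iteratedDeriv 0 f x * iteratedDeriv 2 f x)
      + iteratedDeriv 2 f x * iteratedDeriv 2 f x + iteratedDeriv 1 f x * iteratedDeriv 1 f x)
    (f' := fun x => 2 * f x * (iteratedDeriv 5 f x - iteratedDeriv 3 f x)) ?_ ?_
  · rw [key]
    simp only [e0, e1, h0, h1, hd0, hd1, h2]
    ring
  · intro x _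
    have := ((((((hD 0 x).mul (hD 4 x)).sub ((hD 1 x).mul (hD 3 x))).sub
      ((hD 0 x).mul (hD 2 x))).const_mul 2).add ((hD 2 x).mul (hD 2 x))).add
      ((hD 1 x).mul (hD 1 x))
    refine this.congr_deriv ?_
    simp only [e0, e1, Nat.reduceAdd]
    ring
  · apply Continuous.intervalIntegrable
    have := hc 5
    have := hc 3
    have := hf.continuous
    fun_prop

/-- Weak observability inequality for classical solutions of the damped
linear Kawahara system. -/
theorem kawahara_weak_observability (α : ℝ) (hα : |α| < 1) (u : ℝ → ℝ → ℝ)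
    (hu : ContDiff ℝ (⊤ : ℕ∞) (Function.uncurry u))
    (hpde : ∀ x ∈ Set.Icc (0:ℝ) 1, ∀ t : ℝ,
      deriv (u x) t + iteratedDeriv 3 (fun y => u y t) x
        - iteratedDeriv 5 (fun y => u y t) x = 0)
    (hbc0 : ∀ t : ℝ, u 0 t = 0) (hbc1 : ∀ t : ℝ, u 1 t = 0)
    (hbx0 : ∀ t : ℝ, deriv (fun y => u y t) 0 = 0)
    (hbx1 : ∀ t : ℝ, deriv (fun y => u y t) 1 = 0)
    (hbxx : ∀ t : ℝ, iteratedDeriv 2 (fun y => u y t) 1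
      = α * iteratedDeriv 2 (fun y => u y t) 0) :
    ∀ T : ℝ, 0 < T →
      (1/2) * (∫ x in (0:ℝ)..1, (u x 0)^2)
        ≤ (1/(2*T)) * (∫ t in (0:ℝ)..T, ∫ x in (0:ℝ)..1, (u x t)^2)
          + ((1 - α^2)/2) * ∫ t in (0:ℝ)..T, (iteratedDeriv 2 (fun y => u y t) 0)^2 := by
  have hb := kw_iter u hu
  have hcu : Continuous (Function.uncurry u) := hu.continuous
  have hct := kw_dt u hu
  have hE : Continuous (fun t => ∫ x in (0:ℝ)..1, (u x t)^2) := by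
    apply intervalIntegral.continuous_parametric_intervalIntegral_of_continuous'
      (f := fun t x => (u x t)^2)
    exact (hcu.comp continuous_swap).pow 2
  have hDc : Continuous (fun t => (iteratedDeriv 2 (fun y => u y t) 0)^2) :=
    ((hb 2).continuous.comp (by fun_prop : Continuous (fun t : ℝ => ((0:ℝ), t)))).pow 2
  -- the energy identity
  have hen : ∀ t, (∫ x in (0:ℝ)..1, (u x t)^2) - (∫ x in (0:ℝ)..1, (u x 0)^2)
      = (α^2 - 1) * ∫ s in (0:ℝ)..t, (iteratedDeriv 2 (fun y => u y s) 0)^2 := by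
    intro t
    have hsec : ∀ s, Continuous (fun x => (u x s)^2) := fun s =>
      (hcu.comp (by fun_prop : Continuous (fun x : ℝ => (x, s)))).pow 2
    rw [← intervalIntegral.integral_sub ((hsec t).intervalIntegrable _ _)
      ((hsec 0).intervalIntegrable _ _)]
    have hF : Continuous (Function.uncurry (fun x s => 2 * u x s * deriv (u x) s)) :=
      (continuous_const.mul hcu).mul hct
    have hft : ∀ x, (u x t)^2 - (u x 0)^2 = ∫ s in (0:ℝ)..t, 2 * u x s * deriv (u x) s := by
      intro x
      symm
      have hux : ContDiff ℝ (⊤ : ℕ∞) (u x) := hu.comp (contDiff_const.prodMk contDiff_id)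
      apply intervalIntegral.integral_eq_sub_of_hasDerivAt (f := fun s => (u x s)^2)
      · intro s _
        refine ((hux.differentiable (by simp) s).hasDerivAt.pow 2).congr_deriv ?_
        norm_num
      · exact (hF.comp (by fun_prop : Continuous (fun s : ℝ => (x, s)))).intervalIntegrable _ _
    simp_rw [hft]
    rw [MeasureTheory.intervalIntegral_intervalIntegral_swap]
    · rw [← intervalIntegral.integral_const_mul]
      apply intervalIntegral.integral_congr
      intro s _
      simp only
      rw [← kw_space α (fun y => u y s) (hu.comp (contDiff_id.prodMk contDiff_const))
        (hbc0 s) (hbc1 s) (hbx0 s) (hbx1 s) (hbxx s)]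
      apply intervalIntegral.integral_congr
      intro x hx
      rw [Set.uIcc_of_le zero_le_one] at hx
      have := hpde x hx s
      simp only
      congr 1
      linarith
    · skip
      exact (hF.continuousOn.integrableOn_compact
        (isCompact_uIcc.prod isCompact_uIcc)).mono_set
        (Set.prod_mono Set.uIoc_subset_uIcc Set.uIoc_subset_uIcc)
  intro T hT
  have hα2 : 0 ≤ 1 - α^2 := by
    have := (sq_lt_one_iff_abs_lt_one α).2 hα
    linarith
  set E0 := ∫ x in (0:ℝ)..1, (u x 0)^2 with hE0
  set D := ∫ t in (0:ℝ)..T, (iteratedDeriv 2 (fun y => u y t) 0)^2 with hD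
  have hmono : ∫ t in (0:ℝ)..T, (E0 - (1 - α^2) * D)
      ≤ ∫ t in (0:ℝ)..T, ∫ x in (0:ℝ)..1, (u x t)^2 := by
    apply intervalIntegral.integral_mono_on hT.le (by simp) (hE.intervalIntegrable _ _)
    intro t ht
    have h1 := hen t
    have h2 : (∫ s in (0:ℝ)..t, (iteratedDeriv 2 (fun y => u y s) 0)^2) ≤ D :=
      intervalIntegral.integral_mono_interval le_rfl ht.1 ht.2
        (Filter.Eventually.of_forall fun s => sq_nonneg _) (hDc.intervalIntegrable _ _)
    have h3 := mul_le_mul_of_nonneg_left h2 hα2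
    linarith
  rw [intervalIntegral.integral_const, smul_eq_mul, sub_zero] at hmono
  have h4 := mul_le_mul_of_nonneg_left hmono (by positivity : 0 ≤ 1/(2*T))
  have h5 : 1/(2*T) * (T * (E0 - (1 - α^2) * D)) = 1/2 * E0 - (1 - α^2)/2 * D := by
    field_simp
  linarith
end

section
/- Fix α ∈ ℝ with |α| < 1 and T > 0. There exists a constant c₁ > 0 (depending only on α and T) such that every classical solution u of the damped linear Kawahara system satisfies (1/2)·∫₀ᵀ ∫₀¹ u(x,t)² dx dt ≤ c₁·∫₀ᵀ (∂ₓ²u(0,t))² dt (observability inequality). -/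
open Filter Topology Function

theorem abstract_obs {V : Type*} [AddCommGroup V] [Module ℝ V] (E : V → ℝ) (P : ℝ → V → ℝ)
    (S : ℝ → V →ₗ[ℝ] V)
    (E0 : ∀ u, 0 ≤ E u) (Es : ∀ (c : ℝ) u, E (c • u) = c ^ 2 * E u)
    (P0 : ∀ t u, 0 ≤ t → 0 ≤ P t u) (Ps : ∀ t (c : ℝ) u, P t (c • u) = c ^ 2 * P t u)
    (Pa : ∀ t u v, 0 ≤ t → P t (u + v) ≤ 2 * P t u + 2 * P t v)
    (PS : ∀ h t u, 0 ≤ h → 0 ≤ t → P (h + t) u = P h u + P t (S h u))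
    (ES : ∀ h u, 0 ≤ h → E (S h u) ≤ E u)
    (A : ℝ) (PE : ∀ t u, 0 ≤ t → P t u ≤ A * E u)
    (B : ℝ) (obs : ∀ u, E u ≤ B * P 1 u)
    (T : ℝ) (hT : 0 < T) {ι : Type} [Fintype ι] (ℓ : V →ₗ[ℝ] (ι → ℝ)) (C : ℝ)
    (hl : ∀ u, ‖ℓ u‖ ^ 2 ≤ C * E u)
    (hc : ∀ u, E u ≤ C * (P (T / 2) u + ‖ℓ u‖ ^ 2)) :
    ∃ c : ℝ, 0 < c ∧ ∀ u, E u ≤ c * P T u := by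
  classical
  have Pmono : ∀ s t u, 0 ≤ s → s ≤ t → P s u ≤ P t u := by
    intro s t u hs hst
    have h1 := PS s (t - s) u hs (by linarith)
    have h2 := P0 (t - s) (S s u) (by linarith)
    rw [add_sub_cancel] at h1
    linarith
  have Psub : ∀ t u v, 0 ≤ t → P t (u - v) ≤ 2 * P t u + 2 * P t v := by
    intro t u v ht
    have h1 := Pa t u ((-1 : ℝ) • v) ht
    rw [Ps] at h1
    have : u - v = u + (-1 : ℝ) • v := by simp [sub_eq_add_neg]
    rw [this]; linarith
  by_contra hcon
  push Not at hcon
  have hex : ∀ n : ℕ, ∃ w : V, E w = 1 ∧ P T w ≤ 1 / ((n : ℝ) + 1) := by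
    intro n
    obtain ⟨u, hu⟩ := hcon ((n : ℝ) + 1) (by positivity)
    have hn : (0 : ℝ) < (n : ℝ) + 1 := by positivity
    have hP := P0 T u hT.le
    have hE : 0 < E u := lt_of_le_of_lt (by positivity) hu
    refine ⟨(1 / Real.sqrt (E u)) • u, ?_, ?_⟩
    · rw [Es, div_pow, Real.sq_sqrt hE.le]; field_simp
    · rw [Ps, div_pow, Real.sq_sqrt hE.le]
      rw [one_pow, div_mul_eq_mul_div, one_mul, div_le_div_iff₀ hE hn]
      linarith
  choose w hwE hwP using hex
  let U : Ultrafilter ℕ := hyperfilter ℕ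
  have hU : (U : Filter ℕ) ≤ atTop := by
    rw [← Nat.cofinite_eq_atTop]; exact hyperfilter_le_cofinite
  -- convergence of bounded sequences
  have hbd : ∀ (v : ℕ → V) (M : ℝ), (∀ᶠ n in (U : Filter ℕ), E (v n) ≤ M) →
      ∃ y, Tendsto (fun n => ℓ (v n)) U (𝓝 y) := by
    intro v M hM
    have hcp : IsCompact (Metric.closedBall (0 : ι → ℝ) (Real.sqrt (|C| * |M|))) :=
      isCompact_closedBall _ _
    have hmem : ∀ᶠ n in (U : Filter ℕ),
        ℓ (v n) ∈ Metric.closedBall (0 : ι → ℝ) (Real.sqrt (|C| * |M|)) := by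
      filter_upwards [hM] with n hn
      rw [mem_closedBall_zero_iff]
      apply Real.le_sqrt_of_sq_le
      refine (hl _).trans ?_
      have h0 := E0 (v n)
      calc C * E (v n) ≤ |C| * E (v n) := by gcongr; exact le_abs_self C
        _ ≤ |C| * |M| := by gcongr; exact hn.trans (le_abs_self M)
    obtain ⟨y, _, hy⟩ := hcp.ultrafilter_le_nhds (U.map (fun n => ℓ (v n)))
      (by rw [le_principal_iff]; exact hmem)
    exact ⟨y, hy⟩
  set K := Fintype.card ι with hK
  set δ : ℝ := (T / 2) / (K + 1) with hδ
  have hδ0 : 0 < δ := by positivity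
  have hδT : δ ≤ T / 2 := by
    rw [hδ]; apply div_le_self (by positivity); linarith [Nat.cast_nonneg (α := ℝ) K]
  let τ : ℕ → ℝ := fun j => T / 2 + j * δ
  have hτ0 : ∀ j, T / 2 ≤ τ j := fun j => by
    have : 0 ≤ (j : ℝ) * δ := by positivity
    simp only [τ]; linarith
  have hτp : ∀ j, 0 ≤ τ j := fun j => by linarith [hτ0 j]
  have hτs : ∀ j, τ (j + 1) = δ + τ j := fun j => by simp only [τ]; push_cast; ring
  have hτT : τ (K + 1) = T := by
    simp only [τ, hδ]; push_cast; field_simp; ring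
  have hτm : Monotone τ := monotone_nat_of_le_succ fun j => by rw [hτs]; linarith
  let W : ℕ → Submodule ℝ (ι → ℝ) := fun j =>
    { carrier := {y | ∃ v : ℕ → V, Tendsto (fun n => P (τ j) (v n)) U (𝓝 0) ∧
        Tendsto (fun n => ℓ (v n)) U (𝓝 y)}
      zero_mem' := by
        refine ⟨fun _ => 0, ?_, ?_⟩
        · have := Ps (τ j) 0 (0 : V)
          simp at this
          simp [this]
        · simp
      add_mem' := by
        rintro a b ⟨v, hv1, hv2⟩ ⟨v', hv1', hv2'⟩
        refine ⟨fun n => v n + v' n, ?_, ?_⟩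
        · refine squeeze_zero (fun n => P0 _ _ (hτp j)) (fun n => Pa _ _ _ (hτp j)) ?_
          simpa using (hv1.const_mul 2).add (hv1'.const_mul 2)
        · simpa using hv2.add hv2'
      smul_mem' := by
        rintro c a ⟨v, hv1, hv2⟩
        refine ⟨fun n => c • v n, ?_, ?_⟩
        · simp only [Ps]
          simpa using hv1.const_mul (c ^ 2)
        · simpa using hv2.const_smul c }
  have hWanti : ∀ j, W (j + 1) ≤ W j := by
    rintro j y ⟨v, hv1, hv2⟩
    exact ⟨v, squeeze_zero (fun n => P0 _ _ (hτp j))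
      (fun n => Pmono _ _ _ (hτp j) (hτm (Nat.le_succ j))) hv1, hv2⟩
  have hWeq : ∃ j, j ≤ K ∧ W (j + 1) = W j := by
    by_contra hne
    push Not at hne
    have key : ∀ j, j ≤ K + 1 → Module.finrank ℝ (W j) + j ≤ K := by
      intro j
      induction j with
      | zero =>
        intro _
        have := Submodule.finrank_le (W 0)
        rw [Module.finrank_fintype_fun_eq_card] at this
        simpa using this
      | succ j ih =>
        intro hj
        have h1 := ih (by omega)
        have h2 := Submodule.finrank_lt_finrank_of_lt
          (lt_of_le_of_ne (hWanti j) (hne j (by omega)))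
        omega
    have := key (K + 1) le_rfl
    omega
  obtain ⟨j, hjK, hWj⟩ := hWeq
  have hEto : ∀ v : ℕ → V, Tendsto (fun n => P (τ j) (v n)) U (𝓝 0) →
      Tendsto (fun n => ℓ (v n)) U (𝓝 0) → Tendsto (fun n => E (v n)) U (𝓝 0) := by
    intro v h1 h2
    have h1' : Tendsto (fun n => P (T / 2) (v n)) U (𝓝 0) :=
      squeeze_zero (fun n => P0 _ _ (by positivity))
        (fun n => Pmono _ _ _ (by positivity) (hτ0 j)) h1
    refine squeeze_zero (fun n => E0 _) (fun n => hc _) ?_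
    simpa using (h1'.add (h2.norm.pow 2)).const_mul C
  have hQ : ∀ v : ℕ → V, Tendsto (fun n => P (τ (j + 1)) (v n)) U (𝓝 0) →
      (∃ y, Tendsto (fun n => ℓ (v n)) U (𝓝 y)) →
      Tendsto (fun n => P (τ (j + 1)) (S δ (v n))) U (𝓝 0) ∧
      (∃ y, Tendsto (fun n => ℓ (S δ (v n))) U (𝓝 y)) := by
    rintro v h1 ⟨y, h2⟩
    have h3 : Tendsto (fun n => P (τ j) (S δ (v n))) U (𝓝 0) := by
      refine squeeze_zero (fun n => P0 _ _ (hτp j)) (fun n => ?_) h1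
      rw [hτs, PS _ _ _ hδ0.le (hτp j)]
      linarith [P0 δ (v n) hδ0.le]
    have h1' : Tendsto (fun n => P (T / 2) (v n)) U (𝓝 0) :=
      squeeze_zero (fun n => P0 _ _ (by positivity))
        (fun n => Pmono _ _ _ (by positivity) (hτ0 _)) h1
    have h4 : Tendsto (fun n => C * (P (T / 2) (v n) + ‖ℓ (v n)‖ ^ 2)) U
        (𝓝 (C * (0 + ‖y‖ ^ 2))) := (h1'.add (h2.norm.pow 2)).const_mul C
    have h5 : ∀ᶠ n in (U : Filter ℕ), E (S δ (v n)) ≤ C * (0 + ‖y‖ ^ 2) + 1 := by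
      filter_upwards [h4.eventually_le_const (lt_add_one _)] with n hn
      exact (ES _ _ hδ0.le).trans ((hc _).trans hn)
    obtain ⟨y', hy'⟩ := hbd _ _ h5
    have hmem : y' ∈ W (j + 1) := by
      rw [hWj]; exact ⟨_, h3, hy'⟩
    obtain ⟨v', g1, g2⟩ := hmem
    have g1' : Tendsto (fun n => P (τ j) (v' n)) U (𝓝 0) :=
      squeeze_zero (fun n => P0 _ _ (hτp j))
        (fun n => Pmono _ _ _ (hτp j) (hτm (Nat.le_succ j))) g1
    have hd : Tendsto (fun n => E (S δ (v n) - v' n)) U (𝓝 0) := by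
      apply hEto
      · refine squeeze_zero (fun n => P0 _ _ (hτp j)) (fun n => Psub _ _ _ (hτp j)) ?_
        simpa using (h3.const_mul 2).add (g1'.const_mul 2)
      · simpa using hy'.sub g2
    have hd' : Tendsto (fun n => P (τ (j + 1)) (S δ (v n) - v' n)) U (𝓝 0) := by
      refine squeeze_zero (fun n => P0 _ _ (hτp _)) (fun n => PE _ _ (hτp _)) ?_
      simpa using hd.const_mul A
    refine ⟨?_, y', hy'⟩
    have : ∀ n, P (τ (j + 1)) (S δ (v n)) ≤
        2 * P (τ (j + 1)) (S δ (v n) - v' n) + 2 * P (τ (j + 1)) (v' n) := by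
      intro n
      have := Pa (τ (j + 1)) (S δ (v n) - v' n) (v' n) (hτp _)
      rwa [sub_add_cancel] at this
    refine squeeze_zero (fun n => P0 _ _ (hτp _)) this ?_
    simpa using (hd'.const_mul 2).add (g1.const_mul 2)
  have hit : ∀ (i : ℕ) (v : ℕ → V), Tendsto (fun n => P (τ (j + 1)) (v n)) U (𝓝 0) →
      (∃ y, Tendsto (fun n => ℓ (v n)) U (𝓝 y)) →
      Tendsto (fun n => P (i * δ + τ (j + 1)) (v n)) U (𝓝 0) := by
    intro i
    induction i with
    | zero => intro v h1 _; simpa using h1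
    | succ i ih =>
      intro v h1 h2
      obtain ⟨h3, h4⟩ := hQ v h1 h2
      have h5 := ih _ h3 h4
      have h6 : Tendsto (fun n => P δ (v n)) U (𝓝 0) :=
        squeeze_zero (fun n => P0 _ _ hδ0.le)
          (fun n => Pmono _ _ _ hδ0.le (hδT.trans (hτ0 _))) h1
      have h7 : ∀ n, P ((i + 1 : ℕ) * δ + τ (j + 1)) (v n) =
          P δ (v n) + P (i * δ + τ (j + 1)) (S δ (v n)) := by
        intro n
        have h8 : 0 ≤ (i : ℝ) * δ + τ (j + 1) := by
          have := hτp (j + 1)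
          positivity
        rw [← PS _ _ _ hδ0.le h8]
        congr 1
        push_cast; ring
      simp only [h7]
      simpa using h6.add h5
  have hw1 : Tendsto (fun n => P (τ (j + 1)) (w n)) U (𝓝 0) := by
    have h1 : Tendsto (fun n : ℕ => 1 / ((n : ℝ) + 1)) U (𝓝 0) :=
      tendsto_one_div_add_atTop_nhds_zero_nat.mono_left hU
    refine squeeze_zero (fun n => P0 _ _ (hτp _)) (fun n => ?_) h1
    refine le_trans (Pmono _ T _ (hτp _) ?_) (hwP n)
    rw [← hτT]
    exact hτm (by omega)
  have hw2 := hbd w 1 (Eventually.of_forall fun n => (hwE n).le)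
  obtain ⟨i, hi⟩ := exists_nat_ge (1 / δ)
  have h1 := hit i w hw1 hw2
  have h2 : Tendsto (fun n => P 1 (w n)) U (𝓝 0) := by
    refine squeeze_zero (fun n => P0 _ _ zero_le_one)
      (fun n => Pmono _ _ _ zero_le_one ?_) h1
    rw [div_le_iff₀ hδ0] at hi
    linarith [hτp (j + 1)]
  have h3 : Tendsto (fun n => E (w n)) U (𝓝 0) := by
    refine squeeze_zero (fun n => E0 _) (fun n => obs _) ?_
    simpa using h2.const_mul B
  simp only [hwE] at h3
  exact one_ne_zero (tendsto_nhds_unique tendsto_const_nhds h3)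

noncomputable def KD (k : ℕ) (u : ℝ → ℝ → ℝ) (x t : ℝ) : ℝ := iteratedDeriv k (fun y => u y t) x

noncomputable def KT (u : ℝ → ℝ → ℝ) (x t : ℝ) : ℝ := deriv (u x) t

lemma smooth_dx {f : ℝ → ℝ → ℝ} (hf : ContDiff ℝ (⊤ : ℕ∞) (uncurry f)) :
    ContDiff ℝ (⊤ : ℕ∞) (uncurry (fun x t => deriv (fun y => f y t) x)) := by
  have h1 : (uncurry (fun x t => deriv (fun y => f y t) x)) =
      fun p : ℝ × ℝ => fderiv ℝ (uncurry f) p (1, 0) := by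
    ext ⟨x, t⟩
    have hd : DifferentiableAt ℝ (uncurry f) (x, t) := hf.differentiable (by simp) _
    have h2 : HasDerivAt (fun y : ℝ => (y, t)) ((1 : ℝ), (0 : ℝ)) x :=
      (hasDerivAt_id x).prodMk (hasDerivAt_const x t)
    exact (hd.hasFDerivAt.comp_hasDerivAt x h2).deriv
  rw [h1]
  exact (hf.fderiv_right (m := (⊤ : ℕ∞)) (by simp)).clm_apply contDiff_const

lemma smooth_KT {f : ℝ → ℝ → ℝ} (hf : ContDiff ℝ (⊤ : ℕ∞) (uncurry f)) :
    ContDiff ℝ (⊤ : ℕ∞) (uncurry (KT f)) := by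
  have h1 : (uncurry (KT f)) =
      fun p : ℝ × ℝ => fderiv ℝ (uncurry f) p (0, 1) := by
    ext ⟨x, t⟩
    have hd : DifferentiableAt ℝ (uncurry f) (x, t) := hf.differentiable (by simp) _
    have h2 : HasDerivAt (fun y : ℝ => (x, y)) ((0 : ℝ), (1 : ℝ)) t :=
      (hasDerivAt_const t x).prodMk (hasDerivAt_id t)
    exact (hd.hasFDerivAt.comp_hasDerivAt t h2).deriv
  rw [h1]
  exact (hf.fderiv_right (m := (⊤ : ℕ∞)) (by simp)).clm_apply contDiff_const

lemma smooth_KD {u : ℝ → ℝ → ℝ} (hu : ContDiff ℝ (⊤ : ℕ∞) (uncurry u)) (k : ℕ) :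
    ContDiff ℝ (⊤ : ℕ∞) (uncurry (KD k u)) := by
  induction k with
  | zero =>
    have h : KD 0 u = u := by ext x t; simp [KD]
    rwa [h]
  | succ k ih =>
    have := smooth_dx ih
    have h : (fun x t => deriv (fun y => KD k u y t) x) = KD (k + 1) u := by
      ext x t
      simp only [KD, iteratedDeriv_succ]
    rwa [h] at this

lemma smooth_fst {u : ℝ → ℝ → ℝ} (hu : ContDiff ℝ (⊤ : ℕ∞) (uncurry u)) (t : ℝ) :
    ContDiff ℝ (⊤ : ℕ∞) (fun y => u y t) :=
  hu.comp (contDiff_id.prodMk contDiff_const)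

lemma smooth_snd {u : ℝ → ℝ → ℝ} (hu : ContDiff ℝ (⊤ : ℕ∞) (uncurry u)) (x : ℝ) :
    ContDiff ℝ (⊤ : ℕ∞) (u x) :=
  hu.comp (contDiff_const.prodMk contDiff_id)

lemma hasDerivAt_KD {u : ℝ → ℝ → ℝ} (hu : ContDiff ℝ (⊤ : ℕ∞) (uncurry u)) (k : ℕ) (x t : ℝ) :
    HasDerivAt (fun y => KD k u y t) (KD (k + 1) u x t) x := by
  have h := ((smooth_fst (smooth_KD hu k) t).differentiable (by simp) x).hasDerivAt
  have h2 : deriv (fun y => KD k u y t) x = KD (k + 1) u x t := by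
    simp only [KD, iteratedDeriv_succ]
  rwa [h2] at h

lemma hasDerivAt_KT {u : ℝ → ℝ → ℝ} (hu : ContDiff ℝ (⊤ : ℕ∞) (uncurry u)) (x t : ℝ) :
    HasDerivAt (u x) (KT u x t) t :=
  ((smooth_snd hu x).differentiable (by simp) t).hasDerivAt

lemma KD_zero (u : ℝ → ℝ → ℝ) (x t : ℝ) : KD 0 u x t = u x t := by simp [KD]

lemma int_cont {F : ℝ → ℝ → ℝ} (hF : Continuous (uncurry F)) :
    Continuous (fun t => ∫ x in (0:ℝ)..1, F x t) := by
  apply intervalIntegral.continuous_parametric_intervalIntegral_of_continuous'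
  exact hF.comp continuous_swap

lemma int_time {F F' : ℝ → ℝ → ℝ} (hF : Continuous (uncurry F)) (hF' : Continuous (uncurry F'))
    (hd : ∀ x t, HasDerivAt (F x) (F' x t) t) (a b : ℝ) :
    (∫ x in (0:ℝ)..1, F x b) - (∫ x in (0:ℝ)..1, F x a) =
      ∫ t in a..b, ∫ x in (0:ℝ)..1, F' x t := by
  have hFc : ∀ t, Continuous (fun x => F x t) := fun t => hF.comp (by fun_prop : Continuous fun x : ℝ => (x, t))
  have hFc' : ∀ x, Continuous (fun t => F' x t) := fun x => hF'.comp (by fun_prop : Continuous fun t : ℝ => (x, t))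
  rw [← intervalIntegral.integral_sub ((hFc b).intervalIntegrable _ _)
    ((hFc a).intervalIntegrable _ _)]
  rw [MeasureTheory.intervalIntegral_intervalIntegral_swap]
  · apply intervalIntegral.integral_congr
    intro x _
    simp only
    rw [intervalIntegral.integral_eq_sub_of_hasDerivAt (fun t _ => hd x t)
      ((hFc' x).intervalIntegrable _ _)]
  · have hc : Continuous (uncurry fun t x => F' x t) := hF'.comp continuous_swap
    refine MeasureTheory.IntegrableOn.mono_set (t := Set.uIcc a b ×ˢ Set.uIcc 0 1)
      (hc.continuousOn.integrableOn_compact (isCompact_uIcc.prod isCompact_uIcc)) ?_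
    exact Set.prod_mono Set.uIoc_subset_uIcc Set.uIoc_subset_uIcc

lemma cs_int {g : ℝ → ℝ} (hg : Continuous g) {a b : ℝ} (hab : a ≤ b) :
    (∫ x in a..b, g x) ^ 2 ≤ (b - a) * ∫ x in a..b, (g x) ^ 2 := by
  rcases hab.eq_or_lt with rfl | h
  · simp
  set I := ∫ x in a..b, g x with hI
  set c := I / (b - a)
  have hba : 0 < b - a := by linarith
  have h0 : 0 ≤ ∫ x in a..b, (g x - c) ^ 2 :=
    intervalIntegral.integral_nonneg hab fun x _ => sq_nonneg _
  have h1 : (∫ x in a..b, (g x - c) ^ 2) =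
      (∫ x in a..b, (g x) ^ 2) - 2 * c * I + c ^ 2 * (b - a) := by
    have : ∀ x, (g x - c) ^ 2 = (g x) ^ 2 - (2 * c) * g x + c ^ 2 := fun x => by ring
    simp only [this]
    rw [intervalIntegral.integral_add, intervalIntegral.integral_sub,
      intervalIntegral.integral_const_mul, intervalIntegral.integral_const]
    · simp [hI]; ring
    all_goals apply Continuous.intervalIntegrable; fun_prop
  rw [h1] at h0
  have h2 : c * (b - a) = I := by simp only [c]; field_simp
  have h3 : (b - a) * (∫ x in a..b, (g x) ^ 2) - I ^ 2 =
    (b - a) * ((∫ x in a..b, (g x) ^ 2) - 2 * c * I + c ^ 2 * (b - a)) := by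
    rw [← h2]; ring
  nlinarith [mul_nonneg hba.le h0]

lemma holder_half {v v' : ℝ → ℝ} (hv : ∀ x, HasDerivAt v (v' x) x) (hc : Continuous v')
    {x y : ℝ} (hx : x ∈ Set.Icc (0:ℝ) 1) (hy : y ∈ Set.Icc (0:ℝ) 1) :
    (v x - v y) ^ 2 ≤ |x - y| * ∫ z in (0:ℝ)..1, (v' z) ^ 2 := by
  wlog hxy : y ≤ x generalizing x y
  · have := this hy hx (le_of_not_ge hxy)
    rw [abs_sub_comm]; linarith [this, show (v x - v y) ^ 2 = (v y - v x) ^ 2 by ring]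
  rw [abs_of_nonneg (by linarith),
    ← intervalIntegral.integral_eq_sub_of_hasDerivAt (fun t _ => hv t) (hc.intervalIntegrable y x)]
  refine (cs_int hc hxy).trans ?_
  refine mul_le_mul_of_nonneg_left ?_ (by linarith)
  · apply intervalIntegral.integral_mono_interval hy.1 hxy hx.2
    · exact Eventually.of_forall fun z => sq_nonneg _
    · exact (by fun_prop : Continuous fun z => (v' z) ^ 2).intervalIntegrable _ _

lemma ibp_iter {φ v : ℝ → ℝ} (hφ : ContDiff ℝ (⊤ : ℕ∞) φ) (hv : ContDiff ℝ (⊤ : ℕ∞) v)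
    (h0 : ∀ k, iteratedDeriv k φ 0 = 0) (h1 : ∀ k, iteratedDeriv k φ 1 = 0) (n : ℕ) :
    ∀ m : ℕ, (∫ x in (0:ℝ)..1, iteratedDeriv m φ x * iteratedDeriv n v x) =
      (-1) ^ n * ∫ x in (0:ℝ)..1, iteratedDeriv (m + n) φ x * v x := by
  have hd : ∀ {f : ℝ → ℝ}, ContDiff ℝ (⊤ : ℕ∞) f → ∀ (k : ℕ) (x : ℝ),
      HasDerivAt (iteratedDeriv k f) (iteratedDeriv (k + 1) f x) x := by
    intro f hf k x
    rw [iteratedDeriv_succ]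
    exact (hf.differentiable_iteratedDeriv k (by exact_mod_cast WithTop.coe_lt_top _) x).hasDerivAt
  have hcont : ∀ {f : ℝ → ℝ}, ContDiff ℝ (⊤ : ℕ∞) f → ∀ (k : ℕ), Continuous (iteratedDeriv k f) := by
    intro f hf k
    exact hf.continuous_iteratedDeriv k (by exact_mod_cast le_top)
  induction n with
  | zero => intro m; simp
  | succ n ih =>
    intro m
    rw [intervalIntegral.integral_mul_deriv_eq_deriv_mul (fun x _ => hd hφ m x)
      (fun x _ => hd hv n x) ((hcont hφ _).intervalIntegrable _ _)
      ((hcont hv _).intervalIntegrable _ _), h0, h1, ih (m + 1)]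
    rw [show m + 1 + n = m + (n + 1) by ring]
    ring

lemma exists_bump (c r : ℝ) (hr : 0 < r) (h0 : 0 < c - r) (h1 : c + r < 1) :
    ∃ φ : ℝ → ℝ, ContDiff ℝ (⊤ : ℕ∞) φ ∧ (∀ x, 0 ≤ φ x) ∧ (∀ x, φ x ≠ 0 → |x - c| < r) ∧
      (∫ x in (0:ℝ)..1, φ x) = 1 ∧ (∀ k, iteratedDeriv k φ 0 = 0) ∧
      (∀ k, iteratedDeriv k φ 1 = 0) := by
  let f : ContDiffBump c := ⟨r / 2, r, by positivity, by linarith⟩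
  have hsupp : ∀ x, f.normed MeasureTheory.volume x ≠ 0 → |x - c| < r := by
    intro x hx
    have : x ∈ Function.support (f.normed MeasureTheory.volume) := hx
    rw [f.support_normed_eq] at this
    simpa [Real.dist_eq] using this
  have hz : ∀ x : ℝ, r < |x - c| → ∀ k, iteratedDeriv k (f.normed MeasureTheory.volume) x = 0 := by
    intro x hx k
    have : f.normed MeasureTheory.volume =ᶠ[𝓝 x] fun _ => 0 := by
      have ho : IsOpen {y : ℝ | r < |y - c|} := isOpen_lt continuous_const (by fun_prop)
      filter_upwards [ho.mem_nhds hx] with y hy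
      by_contra hne
      have := hsupp y hne
      exact lt_asymm this hy
    rw [this.iteratedDeriv_eq]
    simp
  refine ⟨f.normed MeasureTheory.volume, f.contDiff_normed, f.nonneg_normed, hsupp, ?_, ?_, ?_⟩
  · rw [intervalIntegral.integral_of_le zero_le_one]
    refine Eq.trans ?_ (f.integral_normed (μ := MeasureTheory.volume))
    apply MeasureTheory.setIntegral_eq_integral_of_forall_compl_eq_zero
    intro x hx
    by_contra hne
    have := abs_lt.1 (hsupp x hne)
    exact hx ⟨by linarith [this.1], by linarith [this.2]⟩
  · apply hz
    rw [lt_abs]; right; linarith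
  · apply hz
    rw [lt_abs]; left; linarith

lemma exists_bumps (δ : ℝ) (hδ : 0 < δ) : ∃ (m : ℕ) (φ : Fin m → ℝ → ℝ),
    (∀ i, ContDiff ℝ (⊤ : ℕ∞) (φ i)) ∧ (∀ i x, 0 ≤ φ i x) ∧
    (∀ i, (∫ x in (0:ℝ)..1, φ i x) = 1) ∧ (∀ i k, iteratedDeriv k (φ i) 0 = 0) ∧
      (∀ i k, iteratedDeriv k (φ i) 1 = 0) ∧
    ∀ x ∈ Set.Icc (0:ℝ) 1, ∃ i, ∀ y, φ i y ≠ 0 → |x - y| ≤ δ := by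
  obtain ⟨m, hm⟩ := exists_nat_gt (1 / δ)
  have hm0 : (0:ℝ) < m := lt_trans (by positivity) hm
  have hmδ : 1 / (m:ℝ) ≤ δ := by
    rw [div_lt_iff₀ hδ] at hm
    rw [div_le_iff₀ hm0]; linarith
  have hb : ∀ i : Fin m, ∃ φ : ℝ → ℝ, ContDiff ℝ (⊤ : ℕ∞) φ ∧ (∀ x, 0 ≤ φ x) ∧
      (∀ x, φ x ≠ 0 → |x - ((i:ℝ) + 1/2) / m| < 1 / (3 * m)) ∧
      (∫ x in (0:ℝ)..1, φ x) = 1 ∧ (∀ k, iteratedDeriv k φ 0 = 0) ∧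
      (∀ k, iteratedDeriv k φ 1 = 0) := by
    intro i
    have hi : ((i:ℕ):ℝ) + 1 ≤ m := by exact_mod_cast i.2
    have hi0 : (0:ℝ) ≤ ((i:ℕ):ℝ) := by positivity
    apply exists_bump
    · positivity
    · have : ((i:ℝ) + 1/2) / m - 1 / (3 * m) = ((i:ℝ) + 1/6) / m := by field_simp; ring
      rw [this]; positivity
    · have : ((i:ℝ) + 1/2) / m + 1 / (3 * m) = ((i:ℝ) + 5/6) / m := by field_simp; ring
      rw [this, div_lt_one hm0]; linarith
  choose φ h1 h2 h3 h4 h5 h6 using hb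
  refine ⟨m, φ, h1, h2, h4, h5, h6, ?_⟩
  intro x hx
  have hmpos : 0 < m := by exact_mod_cast hm0
  -- choose index
  have : ∃ i : Fin m, |x - ((i:ℝ) + 1/2) / m| ≤ 1 / (2 * m) := by
    rcases hx.2.eq_or_lt with rfl | hlt
    · refine ⟨⟨m - 1, by omega⟩, ?_⟩
      simp only
      rw [Nat.cast_sub (by omega : 1 ≤ m)]
      have : (1:ℝ) - ((m:ℝ) - (1:ℕ) + 1/2) / m = 1 / (2 * m) := by field_simp; push_cast; ring
      rw [this, abs_of_pos (by positivity)]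
    · have hnn : 0 ≤ x * m := mul_nonneg hx.1 hm0.le
      have hfl := Nat.floor_le hnn
      have hfl' := Nat.lt_floor_add_one (x * m)
      have hlt' : ⌊x * m⌋₊ < m := by
        rw [Nat.floor_lt hnn]; nlinarith
      refine ⟨⟨⌊x * m⌋₊, hlt'⟩, ?_⟩
      simp only
      have : x - ((⌊x * m⌋₊:ℝ) + 1/2) / m = (x * m - ⌊x * m⌋₊ - 1/2) / m := by
        field_simp; ring
      rw [this, abs_div, abs_of_pos hm0, show 1 / (2 * (m:ℝ)) = (1/2) / m by field_simp]
      gcongr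
      rw [abs_le]; constructor <;> linarith
  obtain ⟨i, hi⟩ := this
  refine ⟨i, fun y hy => ?_⟩
  have h7 := h3 i y hy
  have h8 : |x - y| ≤ |x - ((i:ℝ) + 1/2) / m| + |y - ((i:ℝ) + 1/2) / m| := by
    have := abs_sub (x - ((i:ℝ) + 1/2) / m) (y - ((i:ℝ) + 1/2) / m)
    simpa using this
  have h9 : 1 / (2 * (m:ℝ)) + 1 / (3 * m) ≤ 1 / m := by
    have : 1 / (2 * (m:ℝ)) + 1 / (3 * m) = (5/6) / m := by field_simp; ring
    rw [this]; gcongr; norm_num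
  linarith

structure KSol (α : ℝ) (u : ℝ → ℝ → ℝ) : Prop where
  smooth : ContDiff ℝ (⊤ : ℕ∞) (uncurry u)
  pde : ∀ x ∈ Set.Icc (0:ℝ) 1, ∀ t : ℝ, KT u x t = KD 5 u x t - KD 3 u x t
  b0 : ∀ t, u 0 t = 0
  b1 : ∀ t, u 1 t = 0
  d0 : ∀ t, KD 1 u 0 t = 0
  d1 : ∀ t, KD 1 u 1 t = 0
  dd : ∀ t, KD 2 u 1 t = α * KD 2 u 0 t

noncomputable def KE (u : ℝ → ℝ → ℝ) (t : ℝ) : ℝ := ∫ x in (0:ℝ)..1, (u x t) ^ 2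
noncomputable def KP (T : ℝ) (u : ℝ → ℝ → ℝ) : ℝ := ∫ t in (0:ℝ)..T, (KD 2 u 0 t) ^ 2
/-- space Dirichlet energy -/
noncomputable def KG (u : ℝ → ℝ → ℝ) (t : ℝ) : ℝ := ∫ x in (0:ℝ)..1, (KD 1 u x t) ^ 2

section
variable {α : ℝ} {u : ℝ → ℝ → ℝ}

lemma KSol.cont (hs : KSol α u) : Continuous (uncurry u) := hs.smooth.continuous
lemma KSol.contD (hs : KSol α u) (k : ℕ) : Continuous (uncurry (KD k u)) :=
  (smooth_KD hs.smooth k).continuous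
lemma KSol.contT (hs : KSol α u) : Continuous (uncurry (KT u)) :=
  (smooth_KT hs.smooth).continuous
lemma cont_x {f : ℝ → ℝ → ℝ} (hf : Continuous (uncurry f)) (t : ℝ) : Continuous fun x => f x t :=
  hf.comp (by fun_prop : Continuous fun x : ℝ => (x, t))
lemma cont_t {f : ℝ → ℝ → ℝ} (hf : Continuous (uncurry f)) (x : ℝ) : Continuous fun t => f x t :=
  hf.comp (by fun_prop : Continuous fun t : ℝ => (x, t))

lemma KSol.contKE (hs : KSol α u) : Continuous (KE u) :=
  int_cont (F := fun x t => (u x t) ^ 2) (hs.cont.pow 2)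
lemma KSol.contKG (hs : KSol α u) : Continuous (KG u) :=
  int_cont (F := fun x t => (KD 1 u x t) ^ 2) ((hs.contD 1).pow 2)

/-- the flux -/
noncomputable def KF (u : ℝ → ℝ → ℝ) (x t : ℝ) : ℝ :=
  -2 * KD 0 u x t * KD 2 u x t + KD 1 u x t ^ 2 + 2 * KD 0 u x t * KD 4 u x t
    - 2 * KD 1 u x t * KD 3 u x t + KD 2 u x t ^ 2

lemma KSol.hasDerivAt_KF (hs : KSol α u) (x t : ℝ) :
    HasDerivAt (fun y => KF u y t) (2 * u x t * (KD 5 u x t - KD 3 u x t)) x := by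
  have h := fun k => hasDerivAt_KD hs.smooth k x t
  have := (((((h 0).const_mul (-2)).mul (h 2)).add ((h 1).pow 2)).add
    (((h 0).const_mul 2).mul (h 4))).sub (((h 1).const_mul 2).mul (h 3)) |>.add ((h 2).pow 2)
  refine HasDerivAt.congr_deriv (f := fun y => KF u y t) this ?_
  simp only [KD_zero]
  push_cast
  ring

lemma KSol.KF0 (hs : KSol α u) (t : ℝ) : KF u 0 t = KD 2 u 0 t ^ 2 := by
  simp [KF, KD_zero, hs.b0, hs.d0]
lemma KSol.KF1 (hs : KSol α u) (t : ℝ) : KF u 1 t = α ^ 2 * KD 2 u 0 t ^ 2 := by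
  simp [KF, KD_zero, hs.b1, hs.d1, hs.dd, mul_pow]

lemma KSol.energy (hs : KSol α u) (a b : ℝ) :
    KE u b - KE u a = -(1 - α ^ 2) * ∫ t in a..b, (KD 2 u 0 t) ^ 2 := by
  unfold KE
  have hu := hs.cont
  have hT := hs.contT
  have k1 : Continuous (uncurry fun x t => (u x t) ^ 2) := hu.pow 2
  have k2 : Continuous (uncurry fun x t => 2 * u x t * KT u x t) := (hu.const_mul 2).mul hT
  rw [int_time k1 k2, ← intervalIntegral.integral_const_mul]
  · apply intervalIntegral.integral_congr
    intro t _
    simp only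
    have h1 : (∫ x in (0:ℝ)..1, 2 * u x t * KT u x t) =
        ∫ x in (0:ℝ)..1, 2 * u x t * (KD 5 u x t - KD 3 u x t) := by
      apply intervalIntegral.integral_congr
      intro x hx
      rw [Set.uIcc_of_le zero_le_one] at hx
      simp only [hs.pde x hx]
    rw [h1, intervalIntegral.integral_eq_sub_of_hasDerivAt (fun x _ => hs.hasDerivAt_KF x t),
      hs.KF0, hs.KF1]
    · ring
    · apply Continuous.intervalIntegrable
      exact (((cont_x hu t).const_mul 2).mul ((cont_x (hs.contD 5) t).sub (cont_x (hs.contD 3) t)))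
  · intro x t
    exact HasDerivAt.congr_deriv ((hasDerivAt_KT hs.smooth x t).pow 2) (by simp)

lemma KSol.moment (hs : KSol α u) (a b : ℝ) :
    (∫ x in (0:ℝ)..1, x * (u x b) ^ 2) - (∫ x in (0:ℝ)..1, x * (u x a) ^ 2) =
      ∫ t in a..b, (α ^ 2 * (KD 2 u 0 t) ^ 2 -
        ∫ x in (0:ℝ)..1, (3 * KD 1 u x t ^ 2 + 5 * KD 2 u x t ^ 2)) := by
  have hu := hs.cont
  have hT := hs.contT
  have hfst : Continuous (uncurry fun (x _t : ℝ) => x) := continuous_fst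
  have k1 : Continuous (uncurry fun x t => x * (u x t) ^ 2) := hfst.mul (hu.pow 2)
  have k2 : Continuous (uncurry fun x t => x * (2 * u x t * KT u x t)) :=
    hfst.mul ((hu.const_mul 2).mul hT)
  rw [int_time k1 k2]
  · apply intervalIntegral.integral_congr
    intro t _
    simp only
    have c0 := cont_x hu t
    have c1 := cont_x (hs.contD 1) t
    have c2 := cont_x (hs.contD 2) t
    have c3 := cont_x (hs.contD 3) t
    have c5 := cont_x (hs.contD 5) t
    have h1 : (∫ x in (0:ℝ)..1, x * (2 * u x t * KT u x t)) =
        ∫ x in (0:ℝ)..1, x * (2 * u x t * (KD 5 u x t - KD 3 u x t)) := by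
      apply intervalIntegral.integral_congr
      intro x hx
      rw [Set.uIcc_of_le zero_le_one] at hx
      simp only [hs.pde x hx]
    rw [h1, eq_sub_iff_add_eq, ← intervalIntegral.integral_add
      (by apply Continuous.intervalIntegrable; fun_prop)
      (by apply Continuous.intervalIntegrable; fun_prop)]
    have hd : ∀ x, HasDerivAt (fun y => y * KF u y t - (-2 * KD 0 u y t * KD 1 u y t
        + 2 * KD 0 u y t * KD 3 u y t - 4 * KD 1 u y t * KD 2 u y t))
        (x * (2 * u x t * (KD 5 u x t - KD 3 u x t)) + (3 * KD 1 u x t ^ 2 + 5 * KD 2 u x t ^ 2))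
        x := by
      intro x
      have h := fun k => hasDerivAt_KD hs.smooth k x t
      have := ((hasDerivAt_id x).mul (hs.hasDerivAt_KF x t)).sub
        (((((h 0).const_mul (-2)).mul (h 1)).add (((h 0).const_mul 2).mul (h 3))).sub
          (((h 1).const_mul 4).mul (h 2)))
      refine HasDerivAt.congr_deriv this ?_
      simp only [KD_zero, KF, id]
      ring
    rw [intervalIntegral.integral_eq_sub_of_hasDerivAt (fun x _ => hd x)]
    · simp [hs.KF1, KD_zero, hs.b0, hs.b1, hs.d0, hs.d1]
    · apply Continuous.intervalIntegrable; fun_prop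
  · intro x t
    simpa using ((hasDerivAt_KT hs.smooth x t).pow 2).const_mul x

lemma KE_nonneg (u : ℝ → ℝ → ℝ) (t : ℝ) : 0 ≤ KE u t :=
  intervalIntegral.integral_nonneg zero_le_one fun _ _ => sq_nonneg _
lemma KG_nonneg (u : ℝ → ℝ → ℝ) (t : ℝ) : 0 ≤ KG u t :=
  intervalIntegral.integral_nonneg zero_le_one fun _ _ => sq_nonneg _
lemma KP_nonneg (u : ℝ → ℝ → ℝ) {T : ℝ} (hT : 0 ≤ T) : 0 ≤ KP T u :=
  intervalIntegral.integral_nonneg hT fun _ _ => sq_nonneg _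

lemma KSol.G_bound (hs : KSol α u) (hα : |α| < 1) {T : ℝ} (hT : 0 ≤ T) :
    3 * (∫ t in (0:ℝ)..T, KG u t) ≤ KP T u + KE u 0 := by
  have hm := hs.moment 0 T
  have c2 := hs.contD 2
  have hα2 : α ^ 2 ≤ 1 := by rw [← sq_abs]; nlinarith [abs_nonneg α]
  have h1 : 0 ≤ ∫ x in (0:ℝ)..1, x * (u x T) ^ 2 :=
    intervalIntegral.integral_nonneg zero_le_one fun x hx => mul_nonneg hx.1 (sq_nonneg _)
  have c0 := cont_x hs.cont 0
  have h2 : (∫ x in (0:ℝ)..1, x * (u x 0) ^ 2) ≤ KE u 0 := by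
    apply intervalIntegral.integral_mono_on zero_le_one
    · apply Continuous.intervalIntegrable; fun_prop
    · apply Continuous.intervalIntegrable; fun_prop
    · intro x hx
      nlinarith [hx.1, hx.2, sq_nonneg (u x 0)]
  have c20 := cont_t c2 0
  have hK : Continuous fun t => ∫ x in (0:ℝ)..1, (3 * KD 1 u x t ^ 2 + 5 * KD 2 u x t ^ 2) :=
    int_cont (F := fun x t => 3 * KD 1 u x t ^ 2 + 5 * KD 2 u x t ^ 2)
      ((((hs.contD 1).pow 2).const_mul 3).add ((c2.pow 2).const_mul 5))
  have hKG := hs.contKG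
  have h3 : (∫ t in (0:ℝ)..T, (α ^ 2 * (KD 2 u 0 t) ^ 2 -
        ∫ x in (0:ℝ)..1, (3 * KD 1 u x t ^ 2 + 5 * KD 2 u x t ^ 2))) ≤
      ∫ t in (0:ℝ)..T, ((KD 2 u 0 t) ^ 2 - 3 * KG u t) := by
    apply intervalIntegral.integral_mono_on hT
    · apply Continuous.intervalIntegrable; fun_prop
    · apply Continuous.intervalIntegrable; fun_prop
    · intro t _
      have c1t := cont_x (hs.contD 1) t
      have c2t := cont_x (hs.contD 2) t
      have h4 : 3 * KG u t ≤ ∫ x in (0:ℝ)..1, (3 * KD 1 u x t ^ 2 + 5 * KD 2 u x t ^ 2) := by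
        rw [KG, ← intervalIntegral.integral_const_mul]
        apply intervalIntegral.integral_mono_on zero_le_one
        · apply Continuous.intervalIntegrable; fun_prop
        · apply Continuous.intervalIntegrable; fun_prop
        · intro x _
          nlinarith [sq_nonneg (KD 2 u x t)]
      nlinarith [sq_nonneg (KD 2 u 0 t)]
  rw [← hm, intervalIntegral.integral_sub (by apply Continuous.intervalIntegrable; fun_prop)
    (by apply Continuous.intervalIntegrable; fun_prop),
    intervalIntegral.integral_const_mul] at h3
  have h5 : KP T u = ∫ t in (0:ℝ)..T, (KD 2 u 0 t) ^ 2 := rfl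
  linarith

lemma KSol.KP_split (hs : KSol α u) (a b : ℝ) :
    KP b u = KP a u + ∫ t in a..b, (KD 2 u 0 t) ^ 2 := by
  have c20 := cont_t (hs.contD 2) 0
  unfold KP
  rw [intervalIntegral.integral_add_adjacent_intervals]
  all_goals apply Continuous.intervalIntegrable; fun_prop

lemma KSol.KE_anti (hs : KSol α u) (hα : |α| < 1) {a b : ℝ} (hab : a ≤ b) :
    KE u b ≤ KE u a := by
  have h := hs.energy a b
  have hα2 : α ^ 2 ≤ 1 := by rw [← sq_abs]; nlinarith [abs_nonneg α]
  have h1 : 0 ≤ ∫ t in a..b, (KD 2 u 0 t) ^ 2 :=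
    intervalIntegral.integral_nonneg hab fun x _ => sq_nonneg _
  nlinarith

lemma KSol.KP_le (hs : KSol α u) (hα : |α| < 1) {T : ℝ} : 
    KP T u ≤ (1 / (1 - α ^ 2)) * KE u 0 := by
  have h := hs.energy 0 T
  have hα2 : 0 < 1 - α ^ 2 := by
    have : |α| ^ 2 < 1 := by nlinarith [abs_nonneg α]
    rw [sq_abs] at this; linarith
  have h1 := KE_nonneg u T
  rw [div_mul_eq_mul_div, le_div_iff₀ hα2]
  have h5 : KP T u = ∫ t in (0:ℝ)..T, (KD 2 u 0 t) ^ 2 := rfl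
  rw [← h5] at h
  linarith

lemma KSol.KE_int (hs : KSol α u) {T : ℝ} (hT : 0 ≤ T) :
    T * KE u 0 ≤ (∫ t in (0:ℝ)..T, KE u t) + T * KP T u := by
  have hc := hs.contKE
  have c20 := cont_t (hs.contD 2) 0
  have h1 : (∫ _t in (0:ℝ)..T, (KE u 0 - KP T u)) ≤ ∫ t in (0:ℝ)..T, KE u t := by
    apply intervalIntegral.integral_mono_on hT
    · apply Continuous.intervalIntegrable; fun_prop
    · apply Continuous.intervalIntegrable; fun_prop
    · intro t ht
      have h2 := hs.energy 0 t
      have h3 := hs.KP_split t T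
      have h4 : 0 ≤ ∫ s in t..T, (KD 2 u 0 s) ^ 2 :=
        intervalIntegral.integral_nonneg ht.2 fun x _ => sq_nonneg _
      have h5 : KP t u = ∫ t in (0:ℝ)..t, (KD 2 u 0 t) ^ 2 := rfl
      have h6 := KP_nonneg u ht.1
      rw [← h5] at h2
      nlinarith [mul_nonneg (sq_nonneg α) h6]
  rw [intervalIntegral.integral_const] at h1
  simp only [sub_zero, smul_eq_mul] at h1
  linarith

lemma KSol.poincare (hs : KSol α u) (t : ℝ) : KE u t ≤ KG u t := by
  have c0 := cont_x hs.cont t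
  have h1 : (∫ x in (0:ℝ)..1, (u x t) ^ 2) ≤ ∫ _x in (0:ℝ)..1, KG u t := by
    apply intervalIntegral.integral_mono_on zero_le_one
    · apply Continuous.intervalIntegrable; fun_prop
    · apply Continuous.intervalIntegrable; fun_prop
    · intro x hx
      have h := holder_half (v := fun y => KD 0 u y t) (fun x => hasDerivAt_KD hs.smooth 0 x t)
        (cont_x (hs.contD 1) t) hx (Set.left_mem_Icc.2 zero_le_one)
      simp only [KD_zero, hs.b0, sub_zero] at h
      refine h.trans ?_
      rw [abs_of_nonneg hx.1]
      exact mul_le_of_le_one_left (KG_nonneg u t) hx.2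
  rw [KE]
  simpa using h1

lemma KSol.obs_one (hs : KSol α u) (hα : |α| < 1) : KE u 0 ≤ 2 * KP 1 u := by
  have h1 := hs.KE_int zero_le_one
  have h2 := hs.G_bound hα zero_le_one
  have h3 : (∫ t in (0:ℝ)..1, KE u t) ≤ ∫ t in (0:ℝ)..1, KG u t :=
    intervalIntegral.integral_mono_on zero_le_one (hs.contKE.intervalIntegrable _ _)
      (hs.contKG.intervalIntegrable _ _) fun t _ => hs.poincare t
  linarith

end

lemma KD_add {u v : ℝ → ℝ → ℝ} (hu : ContDiff ℝ (⊤ : ℕ∞) (uncurry u))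
    (hv : ContDiff ℝ (⊤ : ℕ∞) (uncurry v)) (k : ℕ) (x t : ℝ) :
    KD k (u + v) x t = KD k u x t + KD k v x t := by
  have h1 : ContDiffAt ℝ k (fun y => u y t) x :=
    ((smooth_fst hu t).of_le (by exact_mod_cast le_top)).contDiffAt
  have h2 : ContDiffAt ℝ k (fun y => v y t) x :=
    ((smooth_fst hv t).of_le (by exact_mod_cast le_top)).contDiffAt
  exact iteratedDeriv_add h1 h2

lemma KD_smul {u : ℝ → ℝ → ℝ} (hu : ContDiff ℝ (⊤ : ℕ∞) (uncurry u)) (c : ℝ) (k : ℕ) (x t : ℝ) :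
    KD k (c • u) x t = c * KD k u x t := by
  have h1 : ContDiffAt ℝ k (fun y => u y t) x :=
    ((smooth_fst hu t).of_le (by exact_mod_cast le_top)).contDiffAt
  exact iteratedDeriv_const_smul h1 c

lemma KT_add {u v : ℝ → ℝ → ℝ} (hu : ContDiff ℝ (⊤ : ℕ∞) (uncurry u))
    (hv : ContDiff ℝ (⊤ : ℕ∞) (uncurry v)) (x t : ℝ) :
    KT (u + v) x t = KT u x t + KT v x t :=
  ((hasDerivAt_KT hu x t).add (hasDerivAt_KT hv x t)).deriv

lemma KT_smul {u : ℝ → ℝ → ℝ} (hu : ContDiff ℝ (⊤ : ℕ∞) (uncurry u)) (c : ℝ) (x t : ℝ) :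
    KT (c • u) x t = c * KT u x t :=
  ((hasDerivAt_KT hu x t).const_smul c).deriv

/-- The space of classical solutions. -/
def KSub (α : ℝ) : Submodule ℝ (ℝ → ℝ → ℝ) where
  carrier := {u | KSol α u}
  zero_mem' := by
    have hz : uncurry (0 : ℝ → ℝ → ℝ) = fun _ => 0 := rfl
    have hD : ∀ k x t, KD k 0 x t = 0 := by
      intro k x t
      have h : (fun y : ℝ => (0 : ℝ → ℝ → ℝ) y t) = fun _ => 0 := rfl
      simp [KD]
    have hT : ∀ x t, KT 0 x t = 0 := by
      intro x t
      have h : ((0 : ℝ → ℝ → ℝ) x) = fun _ => 0 := rfl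
      simp [KT, h]
    exact ⟨by rw [hz]; exact contDiff_const, by simp [hD, hT], by simp, by simp, by simp [hD],
      by simp [hD], by simp [hD]⟩
  add_mem' := by
    intro u v hu hv
    have hu' : KSol α u := hu
    have hv' : KSol α v := hv
    refine ⟨hu'.smooth.add hv'.smooth, ?_, ?_, ?_, ?_, ?_, ?_⟩
    · intro x hx t
      rw [KT_add hu'.smooth hv'.smooth, KD_add hu'.smooth hv'.smooth,
        KD_add hu'.smooth hv'.smooth, hu'.pde x hx, hv'.pde x hx]
      ring
    · intro t; simp [hu'.b0, hv'.b0]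
    · intro t; simp [hu'.b1, hv'.b1]
    · intro t; simp [KD_add hu'.smooth hv'.smooth, hu'.d0, hv'.d0]
    · intro t; simp [KD_add hu'.smooth hv'.smooth, hu'.d1, hv'.d1]
    · intro t
      rw [KD_add hu'.smooth hv'.smooth, KD_add hu'.smooth hv'.smooth, hu'.dd, hv'.dd]
      ring
  smul_mem' := by
    intro c u hu
    have hu' : KSol α u := hu
    refine ⟨contDiff_const.mul hu'.smooth, ?_, ?_, ?_, ?_, ?_, ?_⟩
    · intro x hx t
      rw [KT_smul hu'.smooth, KD_smul hu'.smooth, KD_smul hu'.smooth, hu'.pde x hx]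
      ring
    · intro t; simp [hu'.b0]
    · intro t; simp [hu'.b1]
    · intro t; simp [KD_smul hu'.smooth, hu'.d0]
    · intro t; simp [KD_smul hu'.smooth, hu'.d1]
    · intro t
      rw [KD_smul hu'.smooth, KD_smul hu'.smooth, hu'.dd]
      ring

lemma KSol.shift {α : ℝ} {u : ℝ → ℝ → ℝ} (hs : KSol α u) (h : ℝ) :
    KSol α (fun x t => u x (h + t)) := by
  refine ⟨?_, ?_, fun t => hs.b0 _, fun t => hs.b1 _, fun t => hs.d0 (h + t),
    fun t => hs.d1 (h + t), fun t => hs.dd (h + t)⟩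
  · exact hs.smooth.comp (contDiff_fst.prodMk (contDiff_const.add contDiff_snd))
  · intro x hx t
    have h1 : KT (fun x t => u x (h + t)) x t = KT u x (h + t) := by
      have := deriv_comp_const_add (u x) h t
      exact this
    rw [h1]
    exact hs.pde x hx (h + t)

/-- Time shift on solutions. -/
def KShift (α h : ℝ) : KSub α →ₗ[ℝ] KSub α where
  toFun u := ⟨fun x t => u.1 x (h + t), KSol.shift u.2 h⟩
  map_add' _ _ := rfl
  map_smul' _ _ := rfl

/-- averages -/
noncomputable def KA (φ : ℝ → ℝ) (u : ℝ → ℝ → ℝ) (t : ℝ) : ℝ := ∫ x in (0:ℝ)..1, φ x * u x t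

lemma pair_bound {ψ : ℝ → ℝ} (hψ : Continuous ψ) : ∃ M : ℝ, 0 ≤ M ∧ ∀ v : ℝ → ℝ, Continuous v →
    |∫ x in (0:ℝ)..1, ψ x * v x| ≤ M * Real.sqrt (∫ x in (0:ℝ)..1, (v x) ^ 2) := by
  obtain ⟨M, hM⟩ := (isCompact_Icc (a := (0:ℝ)) (b := 1)).exists_bound_of_continuousOn
    hψ.continuousOn
  have hM0 : 0 ≤ M := (norm_nonneg _).trans (hM 0 (by simp))
  refine ⟨M, hM0, fun v hv => ?_⟩
  have h1 := cs_int (hψ.mul hv) (zero_le_one (α := ℝ))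
  have h2 : (∫ x in (0:ℝ)..1, (ψ x * v x) ^ 2) ≤ ∫ x in (0:ℝ)..1, M ^ 2 * (v x) ^ 2 := by
    apply intervalIntegral.integral_mono_on zero_le_one
    · apply Continuous.intervalIntegrable; fun_prop
    · apply Continuous.intervalIntegrable; fun_prop
    · intro x hx
      rw [mul_pow]
      have := hM x hx
      rw [Real.norm_eq_abs] at this
      have h3 : ψ x ^ 2 ≤ M ^ 2 := by
        rw [← sq_abs (ψ x)]; gcongr
      gcongr
  rw [intervalIntegral.integral_const_mul] at h2
  apply abs_le_of_sq_le_sq _ (by positivity)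
  rw [mul_pow, Real.sq_sqrt (intervalIntegral.integral_nonneg zero_le_one fun _ _ => sq_nonneg _)]
  simp only [Pi.mul_apply] at h1
  linarith

lemma KA_bounds (α : ℝ) (hα : |α| < 1) {φ : ℝ → ℝ} (hφ : ContDiff ℝ (⊤ : ℕ∞) φ)
    (h0 : ∀ k, iteratedDeriv k φ 0 = 0) (h1 : ∀ k, iteratedDeriv k φ 1 = 0) :
    ∃ M : ℝ, 0 ≤ M ∧ ∀ u, KSol α u →
      (∀ t, 0 ≤ t → |KA φ u t| ≤ M * Real.sqrt (KE u 0)) ∧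
      (∀ s t, 0 ≤ s → s ≤ t → |KA φ u t - KA φ u s| ≤ M * Real.sqrt (KE u 0) * (t - s)) := by
  have hcφ : ∀ k, Continuous (iteratedDeriv k φ) := fun k =>
    hφ.continuous_iteratedDeriv k (by exact_mod_cast le_top)
  obtain ⟨M1, hM1, hb1⟩ := pair_bound hφ.continuous
  obtain ⟨M2, hM2, hb2⟩ := pair_bound ((hcφ 3).sub (hcφ 5))
  refine ⟨M1 + M2, by positivity, fun u hs => ⟨fun t ht => ?_, fun s t h0s hst => ?_⟩⟩
  · refine (hb1 _ (cont_x hs.cont t)).trans ?_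
    gcongr
    · linarith
    · exact hs.KE_anti hα ht
  · have hfst : Continuous (uncurry fun (x _t : ℝ) => φ x) := hφ.continuous.comp continuous_fst
    have k1 : Continuous (uncurry fun x t => φ x * u x t) := hfst.mul hs.cont
    have k2 : Continuous (uncurry fun x t => φ x * KT u x t) := hfst.mul hs.contT
    have e1 : KA φ u t - KA φ u s = ∫ r in s..t, ∫ x in (0:ℝ)..1, φ x * KT u x r := by
      unfold KA
      exact int_time k1 k2 (fun x t => (hasDerivAt_KT hs.smooth x t).const_mul (φ x)) s t
    rw [e1, ← abs_of_nonneg (sub_nonneg.2 hst), ← Real.norm_eq_abs]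
    apply intervalIntegral.norm_integral_le_of_norm_le_const
    intro r hr
    rw [Set.uIoc_of_le hst] at hr
    have hr0 : 0 ≤ r := by linarith [hr.1]
    have e2 : (∫ x in (0:ℝ)..1, φ x * KT u x r) =
        ∫ x in (0:ℝ)..1, (iteratedDeriv 3 φ x - iteratedDeriv 5 φ x) * u x r := by
      have c0 := cont_x hs.cont r
      have c3 := cont_x (hs.contD 3) r
      have c5 := cont_x (hs.contD 5) r
      have cφ := hφ.continuous
      have f3 := hcφ 3
      have f5 := hcφ 5
      have e3 : (∫ x in (0:ℝ)..1, φ x * KT u x r) =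
          ∫ x in (0:ℝ)..1, (φ x * KD 5 u x r - φ x * KD 3 u x r) := by
        apply intervalIntegral.integral_congr
        intro x hx
        rw [Set.uIcc_of_le zero_le_one] at hx
        simp only [hs.pde x hx]
        ring
      have i3 := ibp_iter hφ (smooth_fst hs.smooth r) h0 h1 3 0
      have i5 := ibp_iter hφ (smooth_fst hs.smooth r) h0 h1 5 0
      simp only [iteratedDeriv_zero, zero_add] at i3 i5
      rw [e3, intervalIntegral.integral_sub (by apply Continuous.intervalIntegrable; fun_prop)
        (by apply Continuous.intervalIntegrable; fun_prop)]
      simp only [KD]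
      rw [i3, i5]
      simp only [sub_mul]
      rw [intervalIntegral.integral_sub (by apply Continuous.intervalIntegrable; fun_prop)
        (by apply Continuous.intervalIntegrable; fun_prop)]
      ring
    rw [e2]
    refine (hb2 _ (cont_x hs.cont r)).trans ?_
    gcongr
    · linarith
    · exact hs.KE_anti hα hr0

lemma KA_approx {α : ℝ} {u : ℝ → ℝ → ℝ} (hs : KSol α u) {φ : ℝ → ℝ} (hφ : Continuous φ)
    (hp : ∀ x, 0 ≤ φ x) (hi : (∫ x in (0:ℝ)..1, φ x) = 1) {δ x : ℝ} (hδ : 0 ≤ δ)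
    (hx : x ∈ Set.Icc (0:ℝ) 1) (hφx : ∀ y, φ y ≠ 0 → |x - y| ≤ δ) (t : ℝ) :
    (u x t) ^ 2 ≤ 2 * (KA φ u t) ^ 2 + 2 * δ * KG u t := by
  have c0 := cont_x hs.cont t
  have hG := KG_nonneg u t
  have h1 : u x t - KA φ u t = ∫ y in (0:ℝ)..1, φ y * (u x t - u y t) := by
    simp only [mul_sub]
    rw [intervalIntegral.integral_sub (by apply Continuous.intervalIntegrable; fun_prop)
        (by apply Continuous.intervalIntegrable; fun_prop), intervalIntegral.integral_mul_const,
        hi, one_mul]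
    rfl
  have h2 : |∫ y in (0:ℝ)..1, φ y * (u x t - u y t)| ≤
      ∫ y in (0:ℝ)..1, φ y * Real.sqrt (δ * KG u t) := by
    refine (intervalIntegral.abs_integral_le_integral_abs zero_le_one).trans ?_
    apply intervalIntegral.integral_mono_on zero_le_one
    · apply Continuous.intervalIntegrable; fun_prop
    · apply Continuous.intervalIntegrable; fun_prop
    · intro y hy
      rw [abs_mul, abs_of_nonneg (hp y)]
      by_cases hy0 : φ y = 0
      · simp [hy0]
      · refine mul_le_mul_of_nonneg_left ?_ (hp y)
        apply Real.abs_le_sqrt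
        have h := holder_half (v := fun y => KD 0 u y t) (fun x => hasDerivAt_KD hs.smooth 0 x t)
          (cont_x (hs.contD 1) t) hx hy
        simp only [KD_zero] at h
        exact h.trans (mul_le_mul_of_nonneg_right (hφx y hy0) hG)
  rw [intervalIntegral.integral_mul_const, hi, one_mul, ← h1] at h2
  have h3 : (u x t - KA φ u t) ^ 2 ≤ δ * KG u t := by
    rw [← sq_abs, ← Real.sq_sqrt (mul_nonneg hδ hG)]
    gcongr
  nlinarith [sq_nonneg (u x t - 2 * KA φ u t)]

lemma KSol.compact (α : ℝ) (hα : |α| < 1) (T : ℝ) (hT : 0 < T) :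
    ∃ (ι : Type) (_ : Fintype ι) (l : KSub α →ₗ[ℝ] (ι → ℝ)) (C : ℝ),
      (∀ u, ‖l u‖ ^ 2 ≤ C * KE u.1 0) ∧
      (∀ u, KE u.1 0 ≤ C * (KP T u.1 + ‖l u‖ ^ 2)) := by
  obtain ⟨m, φ, f1, f2, f3, f4, f5, f6⟩ := exists_bumps (T / 4) (by positivity)
  choose M' hM0 hMb using fun i => KA_bounds α hα (f1 i) (f4 i) (f5 i)
  set M := ∑ i, M' i with hM
  have hMnn : 0 ≤ M := Finset.sum_nonneg fun i _ => hM0 i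
  have hMi : ∀ i, M' i ≤ M := fun i =>
    Finset.single_le_sum (f := M') (fun i _ => hM0 i) (Finset.mem_univ i)
  obtain ⟨n, hn⟩ := exists_nat_gt (4 * M * T)
  have hn0 : (0:ℝ) < n := lt_of_le_of_lt (by positivity) hn
  set h : ℝ := T / n with hh
  have hhpos : 0 < h := by positivity
  have hMh : M * h ≤ 1 / 4 := by
    rw [hh, mul_div_assoc', div_le_iff₀ hn0]; linarith
  let l : KSub α →ₗ[ℝ] (Fin m × Fin (n + 1) → ℝ) :=
    { toFun := fun u p => KA (φ p.1) u.1 (p.2 * h)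
      map_add' := by
        intro u v
        ext p
        have cu := cont_x (KSol.cont u.2) (p.2 * h)
        have cv := cont_x (KSol.cont v.2) (p.2 * h)
        have cf := (f1 p.1).continuous
        simp only [KA, Submodule.coe_add, Pi.add_apply, mul_add]
        rw [intervalIntegral.integral_add (by apply Continuous.intervalIntegrable; fun_prop)
          (by apply Continuous.intervalIntegrable; fun_prop)]
      map_smul' := by
        intro c u
        ext p
        simp only [KA, Submodule.coe_smul, Pi.smul_apply, smul_eq_mul, RingHom.id_apply]
        rw [← intervalIntegral.integral_const_mul]
        congr 1
        ext x
        ring }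
  refine ⟨_, inferInstance, l, 12 + M ^ 2, ?_, ?_⟩
  · intro u
    have hE := KE_nonneg u.1 0
    have h1 : ‖l u‖ ≤ M * Real.sqrt (KE u.1 0) := by
      rw [pi_norm_le_iff_of_nonneg (by positivity)]
      intro p
      refine ((hMb p.1 u.1 u.2).1 (p.2 * h) (by positivity)).trans ?_
      gcongr
      exact hMi _
    calc ‖l u‖ ^ 2 ≤ (M * Real.sqrt (KE u.1 0)) ^ 2 := by gcongr
      _ = M ^ 2 * KE u.1 0 := by rw [mul_pow, Real.sq_sqrt hE]
      _ ≤ _ := by nlinarith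
  · intro u
    have hs : KSol α u.1 := u.2
    have hE := KE_nonneg u.1 0
    have hP := KP_nonneg u.1 hT.le
    have hA : ∀ i, ∀ t ∈ Set.Icc 0 T, (KA (φ i) u.1 t) ^ 2 ≤ 2 * ‖l u‖ ^ 2 + KE u.1 0 / 8 := by
      intro i t ht
      have hth : 0 ≤ t / h := div_nonneg ht.1 hhpos.le
      have hj1 := Nat.floor_le hth
      have hj2 := Nat.lt_floor_add_one (t / h)
      have hjn : ⌊t / h⌋₊ < n + 1 := by
        rw [Nat.lt_succ_iff]
        apply Nat.floor_le_of_le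
        rw [div_le_iff₀ hhpos, hh, mul_div_cancel₀ _ hn0.ne']
        exact ht.2
      rw [le_div_iff₀ hhpos] at hj1
      rw [div_lt_iff₀ hhpos] at hj2
      set j := ⌊t / h⌋₊
      have h1 := (hMb i u.1 hs).2 (j * h) t (by positivity) hj1
      have h2 : |KA (φ i) u.1 (j * h)| ≤ ‖l u‖ := norm_le_pi_norm (l u) (i, ⟨j, hjn⟩)
      have h3 : |KA (φ i) u.1 t - KA (φ i) u.1 (j * h)| ≤ 1 / 4 * Real.sqrt (KE u.1 0) := by
        refine h1.trans ?_
        have h4 : t - j * h ≤ h := by linarith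
        have hsq := Real.sqrt_nonneg (KE u.1 0)
        calc M' i * Real.sqrt (KE u.1 0) * (t - j * h)
            ≤ M * Real.sqrt (KE u.1 0) * h := by
              have := hMi i
              have := hM0 i
              have : 0 ≤ t - j * h := by linarith
              gcongr
          _ = (M * h) * Real.sqrt (KE u.1 0) := by ring
          _ ≤ _ := by gcongr
      have h5 : (KA (φ i) u.1 t - KA (φ i) u.1 (j * h)) ^ 2 ≤ KE u.1 0 / 16 := by
        rw [← sq_abs]
        calc _ ≤ (1 / 4 * Real.sqrt (KE u.1 0)) ^ 2 := by gcongr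
          _ = _ := by rw [mul_pow, Real.sq_sqrt hE]; ring
      have h6 : (KA (φ i) u.1 (j * h)) ^ 2 ≤ ‖l u‖ ^ 2 := by
        rw [← sq_abs]; gcongr
      nlinarith [sq_nonneg (KA (φ i) u.1 t - 2 * KA (φ i) u.1 (j * h))]
    have hEt : ∀ t ∈ Set.Icc 0 T, KE u.1 t ≤
        4 * ‖l u‖ ^ 2 + KE u.1 0 / 4 + T / 2 * KG u.1 t := by
      intro t ht
      have c0 := cont_x hs.cont t
      have h1 : (∫ x in (0:ℝ)..1, (u.1 x t) ^ 2) ≤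
          ∫ _x in (0:ℝ)..1, (4 * ‖l u‖ ^ 2 + KE u.1 0 / 4 + T / 2 * KG u.1 t) := by
        apply intervalIntegral.integral_mono_on zero_le_one
        · apply Continuous.intervalIntegrable; fun_prop
        · apply Continuous.intervalIntegrable; fun_prop
        · intro x hx
          obtain ⟨i, hi⟩ := f6 x hx
          have h2 := KA_approx hs (f1 i).continuous (f2 i) (f3 i) (by positivity) hx hi t
          have h3 := hA i t ht
          linarith
      rw [KE]
      simpa using h1
    have hInt1 : (∫ t in (0:ℝ)..T, KE u.1 t) ≤
        ∫ t in (0:ℝ)..T, (4 * ‖l u‖ ^ 2 + KE u.1 0 / 4 + T / 2 * KG u.1 t) := by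
      have cE := hs.contKE
      have cG := hs.contKG
      apply intervalIntegral.integral_mono_on hT.le
      · apply Continuous.intervalIntegrable; fun_prop
      · apply Continuous.intervalIntegrable; fun_prop
      · exact hEt
    have cG := hs.contKG
    rw [intervalIntegral.integral_add (by apply Continuous.intervalIntegrable; fun_prop)
      (by apply Continuous.intervalIntegrable; fun_prop), intervalIntegral.integral_const,
      intervalIntegral.integral_const_mul] at hInt1
    simp only [sub_zero, smul_eq_mul] at hInt1
    have h1 := hs.KE_int hT.le
    have h2 := hs.G_bound hα hT.le
    have h3 : T * KE u.1 0 ≤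
        T * (4 * ‖l u‖ ^ 2 + KE u.1 0 / 4 + (KP T u.1 + KE u.1 0) / 6 + KP T u.1) := by
      have := mul_le_mul_of_nonneg_left h2 (by positivity : 0 ≤ T / 6)
      linarith
    have h4 := le_of_mul_le_mul_left h3 hT
    have h5 : 0 ≤ ‖l u‖ ^ 2 := by positivity
    have h6 : 0 ≤ M ^ 2 * (KP T u.1 + ‖l u‖ ^ 2) := by positivity
    linarith

lemma KSol.obs (α : ℝ) (hα : |α| < 1) (T : ℝ) (hT : 0 < T) :
    ∃ c : ℝ, 0 < c ∧ ∀ u, KSol α u → KE u 0 ≤ c * KP T u := by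
  obtain ⟨ι, _, l, C, h1, h2⟩ := KSol.compact α hα (T / 2) (by positivity)
  suffices key : ∃ c : ℝ, 0 < c ∧ ∀ u : KSub α, KE u.1 0 ≤ c * KP T u.1 by
    obtain ⟨c, hc, hh⟩ := key
    exact ⟨c, hc, fun u hu => hh ⟨u, hu⟩⟩
  refine abstract_obs (V := KSub α) (fun u => KE u.1 0) (fun t u => KP t u.1)
    (KShift α) (fun u => KE_nonneg _ _) ?_ (fun t u ht => KP_nonneg _ ht) ?_ ?_ ?_ ?_
    (1 / (1 - α ^ 2)) (fun t u ht => KSol.KP_le u.2 hα) 2 (fun u => KSol.obs_one u.2 hα)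
    T hT l C h1 h2
  · intro c u
    simp only [KE, Submodule.coe_smul, Pi.smul_apply, smul_eq_mul, mul_pow]
    rw [intervalIntegral.integral_const_mul]
  · intro t c u
    have hu : KSol α u.1 := u.2
    simp only [KP, Submodule.coe_smul, KD_smul hu.smooth, mul_pow]
    rw [intervalIntegral.integral_const_mul]
  · intro t u v ht
    have hu : KSol α u.1 := u.2
    have hv : KSol α v.1 := v.2
    have cu := cont_t (hu.contD 2) 0
    have cv := cont_t (hv.contD 2) 0
    simp only [KP, Submodule.coe_add, KD_add hu.smooth hv.smooth]
    rw [← intervalIntegral.integral_const_mul, ← intervalIntegral.integral_const_mul,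
      ← intervalIntegral.integral_add (by apply Continuous.intervalIntegrable; fun_prop)
      (by apply Continuous.intervalIntegrable; fun_prop)]
    apply intervalIntegral.integral_mono_on ht
    · apply Continuous.intervalIntegrable; fun_prop
    · apply Continuous.intervalIntegrable; fun_prop
    · intro s _
      nlinarith [sq_nonneg (KD 2 u.1 0 s - KD 2 v.1 0 s)]
  · intro h t u _ _
    have hu : KSol α u.1 := u.2
    rw [hu.KP_split h (h + t)]
    congr 1
    have := intervalIntegral.integral_comp_add_left (a := 0) (b := t)
      (fun s => (KD 2 u.1 0 s) ^ 2) h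
    rw [add_zero] at this
    exact this.symm
  · intro h u hh
    have hu : KSol α u.1 := u.2
    have h1 : KE (KShift α h u).1 0 = KE u.1 h := by
      simp [KE, KShift]
    rw [h1]
    exact hu.KE_anti hα hh

/-- Observability inequality: for fixed `|α| < 1` and `T > 0` there is a
constant `c₁ > 0` such that every classical solution of the damped linear
Kawahara system satisfies
`(1/2)∫₀ᵀ∫₀¹ u² ≤ c₁ ∫₀ᵀ (∂ₓ²u(0,t))² dt`. -/
theorem kawahara_observability (α : ℝ) (hα : |α| < 1) (T : ℝ) (hT : 0 < T) :
    ∃ c₁ : ℝ, 0 < c₁ ∧ ∀ (u : ℝ → ℝ → ℝ)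
      (hu : ContDiff ℝ (⊤ : ℕ∞) (Function.uncurry u))
      (hpde : ∀ x ∈ Set.Icc (0:ℝ) 1, ∀ t : ℝ,
        deriv (u x) t + iteratedDeriv 3 (fun y => u y t) x
          - iteratedDeriv 5 (fun y => u y t) x = 0)
      (hbc0 : ∀ t : ℝ, u 0 t = 0) (hbc1 : ∀ t : ℝ, u 1 t = 0)
      (hbx0 : ∀ t : ℝ, deriv (fun y => u y t) 0 = 0)
      (hbx1 : ∀ t : ℝ, deriv (fun y => u y t) 1 = 0)
      (hbxx : ∀ t : ℝ, iteratedDeriv 2 (fun y => u y t) 1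
        = α * iteratedDeriv 2 (fun y => u y t) 0),
      (1/2) * (∫ t in (0:ℝ)..T, ∫ x in (0:ℝ)..1, (u x t)^2)
        ≤ c₁ * ∫ t in (0:ℝ)..T, (iteratedDeriv 2 (fun y => u y t) 0)^2 := by
  obtain ⟨c, hc, h⟩ := KSol.obs α hα T hT
  refine ⟨T * c, by positivity, ?_⟩
  intro u hu hpde hbc0 hbc1 hbx0 hbx1 hbxx
  have hs : KSol α u := by
    refine ⟨hu, ?_, hbc0, hbc1, ?_, ?_, hbxx⟩
    · intro x hx t
      have := hpde x hx t
      simp only [KT, KD]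
      linarith
    · intro t; simp only [KD, iteratedDeriv_one]; exact hbx0 t
    · intro t; simp only [KD, iteratedDeriv_one]; exact hbx1 t
  have h1 := h u hs
  have h2 : (∫ t in (0:ℝ)..T, KE u t) ≤ ∫ _t in (0:ℝ)..T, KE u 0 := by
    apply intervalIntegral.integral_mono_on hT.le
    · exact hs.contKE.intervalIntegrable _ _
    · exact continuous_const.intervalIntegrable _ _
    · intro t ht
      exact hs.KE_anti hα ht.1
  rw [intervalIntegral.integral_const, sub_zero, smul_eq_mul] at h2
  have h3 := KE_nonneg u 0
  have h4 := mul_le_mul_of_nonneg_left h1 hT.le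
  change (1/2) * (∫ t in (0:ℝ)..T, KE u t) ≤ T * c * KP T u
  have h5 : 0 ≤ T * KE u 0 := by positivity
  linarith
end

section
/- Fix α ∈ ℝ with |α| < 1. There exist constants C > 0 and μ > 0 (depending only on α) such that every classical solution u of the damped linear Kawahara system satisfies, for all t ≥ 0, ∫₀¹ u(x,t)² dx ≤ C·e^{−μ·t}·∫₀¹ u(x,0)² dx (exponential decay of the energy). -/
lemma kaw_deriv_integral (G G' : ℝ → ℝ → ℝ) (hG : Continuous (Function.uncurry G))
    (hG' : Continuous (Function.uncurry G'))
    (hd : ∀ x t, HasDerivAt (fun s => G x s) (G' x t) t) (t : ℝ) :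
    HasDerivAt (fun s => ∫ x in (0:ℝ)..1, G x s) (∫ x in (0:ℝ)..1, G' x t) t := by
  have hcomp : IsCompact (Set.Icc (0:ℝ) 1 ×ˢ Set.Icc (t-1) (t+1)) :=
    isCompact_Icc.prod isCompact_Icc
  obtain ⟨B, hB⟩ := hcomp.exists_bound_of_continuousOn hG'.continuousOn
  have hGs : ∀ s, Continuous (fun x => G x s) := fun s =>
    hG.comp (Continuous.prodMk continuous_id continuous_const)
  have hGs' : ∀ s, Continuous (fun x => G' x s) := fun s =>
    hG'.comp (Continuous.prodMk continuous_id continuous_const)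
  refine (intervalIntegral.hasDerivAt_integral_of_dominated_loc_of_deriv_le
    (F := fun s x => G x s) (F' := fun s x => G' x s) (bound := fun _ => B)
    (s := Set.Icc (t-1) (t+1)) (μ := MeasureTheory.volume)
    (Icc_mem_nhds (by linarith) (by linarith)) ?_ ?_ ?_ ?_ ?_ ?_).2
  · exact Filter.Eventually.of_forall fun s => (hGs s).aestronglyMeasurable
  · exact (hGs t).intervalIntegrable _ _
  · exact (hGs' t).aestronglyMeasurable
  · refine Filter.Eventually.of_forall fun x hx s hs => ?_
    rw [Set.uIoc_of_le zero_le_one] at hx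
    exact hB (x, s) ⟨⟨hx.1.le, hx.2⟩, hs⟩
  · exact intervalIntegrable_const
  · exact Filter.Eventually.of_forall fun x _ s _ => hd x s

lemma kaw_space (M α : ℝ) (hM : (M + 1) * α ^ 2 ≤ M) (f : ℝ → ℝ)
    (hf : ContDiff ℝ (⊤ : ℕ∞) f) (h0 : f 0 = 0) (h1 : f 1 = 0)
    (h0' : deriv f 0 = 0) (h1' : deriv f 1 = 0)
    (h2 : iteratedDeriv 2 f 1 = α * iteratedDeriv 2 f 0) :
    ∫ x in (0:ℝ)..1, 2 * (M + x) * f x * (iteratedDeriv 5 f x - iteratedDeriv 3 f x)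
      ≤ -2 * ∫ x in (0:ℝ)..1, (f x) ^ 2 := by
  have hc : ∀ k : ℕ, Continuous (iteratedDeriv k f) := fun k =>
    hf.continuous_iteratedDeriv k (by exact_mod_cast le_top)
  have hd : ∀ k : ℕ, ∀ x, HasDerivAt (iteratedDeriv k f) (iteratedDeriv (k+1) f x) x := by
    intro k x
    rw [iteratedDeriv_succ]
    exact (hf.differentiable_iteratedDeriv k (by exact_mod_cast WithTop.coe_lt_top k) x).hasDerivAt
  obtain ⟨d, hdd⟩ : ∃ d : ℕ → ℝ → ℝ, d = fun k => iteratedDeriv k f := ⟨_, rfl⟩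
  have e0 : f = d 0 := by rw [hdd]; simp
  have e1 : deriv f = d 1 := by rw [hdd]; simp
  have ek : ∀ k, iteratedDeriv k f = d k := fun k => by rw [hdd]
  rw [e1] at h0' h1'
  simp only [ek] at hc hd h2 ⊢
  clear ek hdd e1 hf
  subst e0
  have c0 := hc 0
  have c1 := hc 1
  have c2 := hc 2
  have c3 := hc 3
  have c4 := hc 4
  have c5 := hc 5
  let F : ℝ → ℝ := fun x => 2 * ((M + x) * d 0 x * d 4 x - (d 0 x + (M + x) * d 1 x) * d 3 x
    + (M + x) * (d 2 x * d 2 x) / 2 + 2 * (d 1 x * d 2 x))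
    - 2 * ((M + x) * d 0 x * d 2 x - d 0 x * d 1 x - (M + x) * (d 1 x * d 1 x) / 2)
    - 3 * ((1/2 - x) * (d 0 x * d 0 x))
  let F' : ℝ → ℝ := fun x => 2 * (M + x) * d 0 x * (d 5 x - d 3 x) + 5 * d 2 x ^ 2 + 3 * d 1 x ^ 2
    + 3 * d 0 x ^ 2 - 6 * (1/2 - x) * d 0 x * d 1 x
  have hF : ∀ x, HasDerivAt F (F' x) x := by
    intro x
    have k0 := hd 0 x
    have k1 := hd 1 x
    have k2 := hd 2 x
    have k3 := hd 3 x
    have k4 := hd 4 x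
    have w : HasDerivAt (fun x : ℝ => M + x) 1 x := (hasDerivAt_id x).const_add M
    have p : HasDerivAt (fun x : ℝ => 1/2 - x) (-1) x := (hasDerivAt_id x).const_sub (1/2)
    have := ((((((w.mul k0).mul k4).sub ((k0.add (w.mul k1)).mul k3)).add
      ((w.mul (k2.mul k2)).div_const 2)).add ((k1.mul k2).const_mul 2)).const_mul 2).sub
      (((((w.mul k0).mul k2).sub (k0.mul k1)).sub ((w.mul (k1.mul k1)).div_const 2)).const_mul 2)
      |>.sub ((p.mul (k0.mul k0)).const_mul 3)
    refine this.congr_deriv ?_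
    simp only [F', Pi.mul_apply, Pi.add_apply]
    norm_num
    ring
  have cF' : Continuous F' := by fun_prop
  have key := intervalIntegral.integral_eq_sub_of_hasDerivAt (a := 0) (b := 1)
    (fun x _ => hF x) (cF'.intervalIntegrable _ _)
  have hle : F 1 - F 0 ≤ 0 := by
    simp only [F, h0, h1, h0', h1', h2]
    nlinarith [mul_nonneg (sub_nonneg.2 hM) (sq_nonneg (d 2 0))]
  have hmono : ∫ x in (0:ℝ)..1, (2 * (M + x) * d 0 x * (d 5 x - d 3 x) + 2 * d 0 x ^ 2)
      ≤ ∫ x in (0:ℝ)..1, F' x := by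
    apply intervalIntegral.integral_mono_on zero_le_one
      (Continuous.intervalIntegrable (by fun_prop) _ _) (cF'.intervalIntegrable _ _)
    intro x hx
    have hx2 : 0 ≤ 1/4 - (1/2 - x)^2 := by nlinarith [hx.1, hx.2]
    simp only [F']
    nlinarith [sq_nonneg (d 2 x), sq_nonneg (d 1 x - (1/2 - x) * d 0 x),
      mul_nonneg hx2 (sq_nonneg (d 0 x)), sq_nonneg (d 0 x)]
  rw [intervalIntegral.integral_add (Continuous.intervalIntegrable (by fun_prop) _ _)
    (Continuous.intervalIntegrable (by fun_prop) _ _),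
    intervalIntegral.integral_const_mul] at hmono
  linarith

/-- Exponential decay of the energy: for fixed `|α| < 1` there are `C > 0`
and `μ > 0` such that every classical solution of the damped linear Kawahara
system satisfies `∫₀¹ u(x,t)² dx ≤ C e^{-μ t} ∫₀¹ u(x,0)² dx` for `t ≥ 0`. -/
theorem kawahara_exponential_decay (α : ℝ) (hα : |α| < 1) :
    ∃ C : ℝ, 0 < C ∧ ∃ μ : ℝ, 0 < μ ∧ ∀ (u : ℝ → ℝ → ℝ)
      (hu : ContDiff ℝ (⊤ : ℕ∞) (Function.uncurry u))
      (hpde : ∀ x ∈ Set.Icc (0:ℝ) 1, ∀ t : ℝ,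
        deriv (u x) t + iteratedDeriv 3 (fun y => u y t) x
          - iteratedDeriv 5 (fun y => u y t) x = 0)
      (hbc0 : ∀ t : ℝ, u 0 t = 0) (hbc1 : ∀ t : ℝ, u 1 t = 0)
      (hbx0 : ∀ t : ℝ, deriv (fun y => u y t) 0 = 0)
      (hbx1 : ∀ t : ℝ, deriv (fun y => u y t) 1 = 0)
      (hbxx : ∀ t : ℝ, iteratedDeriv 2 (fun y => u y t) 1
        = α * iteratedDeriv 2 (fun y => u y t) 0),
      ∀ t : ℝ, 0 ≤ t →
        (∫ x in (0:ℝ)..1, (u x t)^2)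
          ≤ C * Real.exp (-μ * t) * ∫ x in (0:ℝ)..1, (u x 0)^2 := by
  have hα2 : α ^ 2 < 1 := (sq_lt_one_iff_abs_lt_one α).2 hα
  obtain ⟨M, hMdef⟩ : ∃ M : ℝ, M = 1 / (1 - α ^ 2) := ⟨_, rfl⟩
  have hpos : 0 < 1 - α ^ 2 := by linarith
  have hM0 : 0 < M := by rw [hMdef]; positivity
  have hM1 : M * (1 - α ^ 2) = 1 := by rw [hMdef]; field_simp
  have hM : (M + 1) * α ^ 2 ≤ M := by nlinarith
  clear hMdef
  refine ⟨(M + 1) / M, by positivity, 2 / (M + 1), by positivity, ?_⟩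
  intro u hu hpde hbc0 hbc1 hbx0 hbx1 hbxx t ht
  have hcu : Continuous (Function.uncurry u) := hu.continuous
  have hut : ∀ x s, HasDerivAt (u x) (fderiv ℝ (Function.uncurry u) (x, s) (0, 1)) s := by
    intro x s
    have h1 : HasFDerivAt (Function.uncurry u) (fderiv ℝ (Function.uncurry u) (x, s)) (x, s) :=
      (hu.differentiable (by simp) (x, s)).hasFDerivAt
    have h2 : HasDerivAt (fun r : ℝ => (x, r)) ((0:ℝ), (1:ℝ)) s :=
      (hasDerivAt_const s x).prodMk (hasDerivAt_id s)
    exact h1.comp_hasDerivAt s h2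
  obtain ⟨v, hv⟩ : ∃ v : ℝ → ℝ → ℝ,
      v = fun x s => fderiv ℝ (Function.uncurry u) (x, s) (0, 1) := ⟨_, rfl⟩
  have hcv : Continuous (Function.uncurry v) := by
    have := (hu.continuous_fderiv (by simp)).clm_apply
      (continuous_const (y := ((0:ℝ), (1:ℝ))))
    rw [hv]
    exact this
  replace hut : ∀ x s, HasDerivAt (u x) (v x s) s := by
    intro x s; rw [hv]; exact hut x s
  clear hv
  have hus : ∀ s, Continuous (fun x => u x s) := fun s =>
    hcu.comp (Continuous.prodMk continuous_id continuous_const)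
  let E : ℝ → ℝ := fun s => ∫ x in (0:ℝ)..1, (u x s) ^ 2
  let V : ℝ → ℝ := fun s => ∫ x in (0:ℝ)..1, (M + x) * (u x s) ^ 2
  let V' : ℝ → ℝ := fun s => ∫ x in (0:ℝ)..1, 2 * (M + x) * u x s * v x s
  have hcu' : Continuous (fun p : ℝ × ℝ => u p.1 p.2) := hcu
  have hcv' : Continuous (fun p : ℝ × ℝ => v p.1 p.2) := hcv
  have hVd : ∀ s, HasDerivAt V (V' s) s := by
    intro s
    refine kaw_deriv_integral (fun x s => (M + x) * (u x s) ^ 2)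
      (fun x s => 2 * (M + x) * u x s * v x s) ?_ ?_ ?_ s
    · simp only [Function.uncurry_def]; fun_prop
    · simp only [Function.uncurry_def]; fun_prop
    · intro x r
      refine (((hut x r).pow 2).const_mul (M + x)).congr_deriv ?_
      norm_num
      ring
  have hV' : ∀ s, V' s ≤ -2 * E s := by
    intro s
    have hsm : ContDiff ℝ (⊤ : ℕ∞) (fun y => u y s) :=
      hu.comp (contDiff_id.prodMk contDiff_const)
    have := kaw_space M α hM (fun y => u y s) hsm (hbc0 s) (hbc1 s) (hbx0 s) (hbx1 s) (hbxx s)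
    refine le_trans (le_of_eq ?_) this
    apply intervalIntegral.integral_congr
    intro x hx
    rw [Set.uIcc_of_le zero_le_one] at hx
    have h := hpde x hx s
    rw [(hut x s).deriv] at h
    have h' : v x s = iteratedDeriv 5 (fun y => u y s) x - iteratedDeriv 3 (fun y => u y s) x := by
      linarith
    simp only [h']
  have hVlow : ∀ s, M * E s ≤ V s := by
    intro s
    have hc := hus s
    simp only [E, V]
    rw [← intervalIntegral.integral_const_mul]
    apply intervalIntegral.integral_mono_on zero_le_one
      (Continuous.intervalIntegrable (by fun_prop) _ _)
      (Continuous.intervalIntegrable (by fun_prop) _ _)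
    intro x hx
    nlinarith [mul_nonneg hx.1 (sq_nonneg (u x s))]
  have hVup : ∀ s, V s ≤ (M + 1) * E s := by
    intro s
    have hc := hus s
    simp only [E, V]
    rw [← intervalIntegral.integral_const_mul]
    apply intervalIntegral.integral_mono_on zero_le_one
      (Continuous.intervalIntegrable (by fun_prop) _ _)
      (Continuous.intervalIntegrable (by fun_prop) _ _)
    intro x hx
    nlinarith [mul_nonneg (sub_nonneg.2 hx.2) (sq_nonneg (u x s))]
  obtain ⟨m, hm⟩ : ∃ m : ℝ, m = 2 / (M + 1) := ⟨_, rfl⟩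
  have hm0 : 0 < m := by rw [hm]; positivity
  have hmM : m * (M + 1) = 2 := by rw [hm]; field_simp
  rw [← hm]
  have hanti : Antitone (fun s => V s * Real.exp (m * s)) := by
    apply antitone_of_hasDerivAt_nonpos
      (f' := fun s => V' s * Real.exp (m * s) + V s * (Real.exp (m * s) * (m * 1)))
    · intro s
      exact (hVd s).mul (((hasDerivAt_id s).const_mul m).exp)
    · intro s
      have h1 : V' s + m * V s ≤ 0 := by
        have := mul_le_mul_of_nonneg_left (hVup s) hm0.le
        have e : m * ((M + 1) * E s) = 2 * E s := by rw [← mul_assoc, hmM]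
        linarith [hV' s]
      have := mul_nonpos_of_nonpos_of_nonneg h1 (Real.exp_pos (m * s)).le
      simp only [Pi.zero_apply]
      linarith
  have h := hanti ht
  simp only [mul_zero, Real.exp_zero, mul_one] at h
  have hfin : M * E t * Real.exp (m * t) ≤ (M + 1) * E 0 :=
    le_trans (mul_le_mul_of_nonneg_right (hVlow t) (Real.exp_pos _).le) (h.trans (hVup 0))
  change E t ≤ (M + 1) / M * Real.exp (-m * t) * E 0
  have he : Real.exp (-m * t) * Real.exp (m * t) = 1 := by
    rw [← Real.exp_add]; simp
  have hep := Real.exp_pos (-m * t)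
  calc E t = (M * E t * Real.exp (m * t)) * (Real.exp (-m * t) / M) := by
        have hMM : M * M⁻¹ = 1 := mul_inv_cancel₀ hM0.ne'
        rw [div_eq_mul_inv]
        linear_combination (-E t) * he - E t * Real.exp (m * t) * Real.exp (-m * t) * hMM
    _ ≤ ((M + 1) * E 0) * (Real.exp (-m * t) / M) :=
        mul_le_mul_of_nonneg_right hfin (by positivity)
    _ = _ := by ring
end
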